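/- Let χ₁, χ₂ : F^× → E^× be unramified smooth characters (trivial on U_F) such that σ = Ind_B^G(χ₁,χ₂) is irreducible (i.e. χ₁/(ωχ₂) ≠ ω^{±1}), let m ∈ ℤ and 0 ≤ n < q, and set λ̃ = χ₁(π)π^m, μ̃ = ω(π)χ₂(π)π^m. If |λ̃μ̃qπ^n| = 1, |λ̃| ≤ |q^{-1}π^{-n}| and |μ̃| ≤ |q^{-1}π^{-n}|, then the locally algebraic representation ρ = τ ⊗ σ of G = GL₂(F) on V_τ ⊗_E V_σ (with diagonal action g·(v⊗f) = τ(g)v ⊗ σ(g)f) admits an integral structure. -/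

import Mathlib

open scoped Classical
open Matrix

noncomputable section

namespace BS

variable (E : Type) [Field E]

/-- The ring of integers of a subfield `F` of `E`, with respect to a nonarchimedean
absolute value on `E`, as an additive subgroup of `F`. -/
def OFadd (abs : AbsoluteValue E ℝ)
    (na : ∀ x y : E, abs (x + y) ≤ max (abs x) (abs y))
    (F : Subfield E) : AddSubgroup F where
  carrier := {x | abs (x : E) ≤ 1}
  zero_mem' := by simp
  add_mem' := by
    intro a b ha hb
    simp only [Set.mem_setOf_eq] at *
    have h : ((a + b : F) : E) = (a : E) + (b : E) := by push_cast; ring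
    rw [h]
    exact le_trans (na _ _) (max_le ha hb)
  neg_mem' := by
    intro a ha
    simp only [Set.mem_setOf_eq] at *
    have h : ((-a : F) : E) = -(a : E) := by push_cast; ring
    rw [h, abs.map_neg]
    exact ha

/-- `W = F/O_F`. -/
abbrev Wq (abs : AbsoluteValue E ℝ)
    (na : ∀ x y : E, abs (x + y) ≤ max (abs x) (abs y))
    (F : Subfield E) : Type := F ⧸ OFadd E abs na F

/-- The canonical projection `F → W = F/O_F`. -/
def mkW (abs : AbsoluteValue E ℝ)
    (na : ∀ x y : E, abs (x + y) ≤ max (abs x) (abs y))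
    (F : Subfield E) : F →+ Wq E abs na F := QuotientAddGroup.mk' _

/-- Multiplication by `π` on `W = F/O_F`. -/
def pmulW (abs : AbsoluteValue E ℝ)
    (na : ∀ x y : E, abs (x + y) ≤ max (abs x) (abs y))
    (F : Subfield E) (π : F) (hπ : abs (π : E) ≤ 1) :
    Wq E abs na F →+ Wq E abs na F :=
  QuotientAddGroup.map _ _ (AddMonoidHom.mulLeft π) (by
    intro x hx
    simp only [AddSubgroup.mem_comap, AddMonoidHom.coe_mulLeft]
    show abs ((π * x : F) : E) ≤ 1
    have h : ((π * x : F) : E) = (π : E) * (x : E) := by push_cast; ring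
    rw [h, abs.map_mul]
    have hx' : abs (x : E) ≤ 1 := hx
    nlinarith [abs.nonneg (x : E), abs.nonneg (π : E)])


/-- Extension of a character `χ : F^× → E^×` to `F`, by `0` at `0`. -/
def extChar (F : Subfield E) (χ : Fˣ →* Eˣ) (x : F) : E :=
  if h : x = 0 then 0 else (χ (Units.mk0 x h) : E)

/-- A matrix over the subfield `F`, viewed over `E`. -/
def matE (F : Subfield E) (g : Matrix (Fin 2) (Fin 2) F) : Matrix (Fin 2) (Fin 2) E :=
  fun i j => (g i j : E)

/-- The rational representation `τ = det(·)^m ⊗ Sym^n` on `V_τ = E[u]^{≤n}`, realized on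
polynomials: `τ([[a,b],[c,d]])·u^i = (ad−bc)^m (a+cu)^{n−i} (b+du)^i`. -/
def tauPoly (m : ℤ) (n : ℕ) (g : Matrix (Fin 2) (Fin 2) E) (P : Polynomial E) :
    Polynomial E :=
  ((g 0 0 * g 1 1 - g 0 1 * g 1 0) ^ m) •
    ∑ i ∈ Finset.range (n + 1), P.coeff i •
      ((Polynomial.C (g 0 0) + Polynomial.C (g 1 0) * Polynomial.X) ^ (n - i) *
       (Polynomial.C (g 0 1) + Polynomial.C (g 1 1) * Polynomial.X) ^ i)

/-- Membership in `σ = Ind_B^G(χ₁,χ₂)`: `f : G → E` satisfies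
`f([[t₁,s],[0,t₂]]g) = χ₁(t₁)χ₂(t₂)f(g)` and is right-invariant under some (open) principal
congruence subgroup of `GL₂(O_F)`. -/
def IsIndFun (abs : AbsoluteValue E ℝ) (F : Subfield E) (π : F)
    (χ1 χ2 : Fˣ →* Eˣ) (f : GL (Fin 2) F → E) : Prop :=
  (∀ b : GL (Fin 2) F, (b : Matrix (Fin 2) (Fin 2) F) 1 0 = 0 →
    ∀ g : GL (Fin 2) F, f (b * g) =
      extChar E F χ1 ((b : Matrix (Fin 2) (Fin 2) F) 0 0) *
      extChar E F χ2 ((b : Matrix (Fin 2) (Fin 2) F) 1 1) * f g) ∧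
  (∃ N : ℕ, ∀ g h : GL (Fin 2) F,
    (∀ i j : Fin 2, abs ((((h : Matrix (Fin 2) (Fin 2) F) i j : F) : E) -
      (((1 : Matrix (Fin 2) (Fin 2) F) i j : F) : E)) ≤ abs (π : E) ^ N) →
    f (g * h) = f g)

/-- The locally algebraic representation `ρ = τ ⊗ σ` realized on functions
`G → V_τ = E[u]^{≤n}`: the element `v ⊗ f` of `V_τ ⊗_E V_σ` corresponds to the function
`g ↦ f(g)·v`, and `(ρ(g)Φ)(g′) = τ(g)(Φ(g′g))`. -/
def rhoAct (F : Subfield E) (m : ℤ) (n : ℕ)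
    (g : GL (Fin 2) F) (Φ : GL (Fin 2) F → Polynomial E) : GL (Fin 2) F → Polynomial E :=
  fun g' => tauPoly E m n (matE E F (g : Matrix (Fin 2) (Fin 2) F)) (Φ (g' * g))

/-- The space `V_ρ = V_τ ⊗_E V_σ`, realized as the span of the functions `g ↦ f(g)·v`
with `v ∈ E[u]^{≤n}` and `f ∈ V_σ`. -/
def Vrho (abs : AbsoluteValue E ℝ) (F : Subfield E) (π : F)
    (χ1 χ2 : Fˣ →* Eˣ) (n : ℕ) : Submodule E (GL (Fin 2) F → Polynomial E) :=
  Submodule.span E {Φ | ∃ (v : Polynomial E) (f : GL (Fin 2) F → E),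
    v.degree ≤ (n : WithBot ℕ) ∧ IsIndFun E abs F π χ1 χ2 f ∧ Φ = fun g => f g • v}

section Group

variable {k : Type} [Field k]

/-- The invertible matrix with entries `a b c d`. -/
def mk2 (a b c d : k) (h : a * d - b * c ≠ 0) : GL (Fin 2) k :=
  Matrix.GeneralLinearGroup.mkOfDetNeZero !![a, b; c, d] (by simpa [Matrix.det_fin_two] using h)

@[simp] lemma mk2_00 (a b c d : k) (h : a * d - b * c ≠ 0) : mk2 a b c d h 0 0 = a := rfl
@[simp] lemma mk2_01 (a b c d : k) (h : a * d - b * c ≠ 0) : mk2 a b c d h 0 1 = b := rfl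
@[simp] lemma mk2_10 (a b c d : k) (h : a * d - b * c ≠ 0) : mk2 a b c d h 1 0 = c := rfl
@[simp] lemma mk2_11 (a b c d : k) (h : a * d - b * c ≠ 0) : mk2 a b c d h 1 1 = d := rfl

lemma gl2_ext {g h : GL (Fin 2) k} (h00 : g 0 0 = h 0 0) (h01 : g 0 1 = h 0 1)
    (h10 : g 1 0 = h 1 0) (h11 : g 1 1 = h 1 1) : g = h := by
  apply Units.ext
  ext i j
  fin_cases i <;> fin_cases j <;> assumption

lemma gl2_mul (g h : GL (Fin 2) k) (i j : Fin 2) :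
    (g * h) i j = g i 0 * h 0 j + g i 1 * h 1 j := by
  rw [Matrix.GeneralLinearGroup.coe_mul, Matrix.mul_apply, Fin.sum_univ_two]

@[simp] lemma gl2_one_00 : (1 : GL (Fin 2) k) 0 0 = 1 := rfl
@[simp] lemma gl2_one_01 : (1 : GL (Fin 2) k) 0 1 = 0 := rfl
@[simp] lemma gl2_one_10 : (1 : GL (Fin 2) k) 1 0 = 0 := rfl
@[simp] lemma gl2_one_11 : (1 : GL (Fin 2) k) 1 1 = 1 := rfl

lemma gl2_det (g : GL (Fin 2) k) :
    ((Matrix.GeneralLinearGroup.det g : kˣ) : k) = g 0 0 * g 1 1 - g 0 1 * g 1 0 := by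
  rw [Matrix.GeneralLinearGroup.val_det_apply, Matrix.det_fin_two]

lemma gl2_det_ne (g : GL (Fin 2) k) : g 0 0 * g 1 1 - g 0 1 * g 1 0 ≠ 0 := by
  rw [← gl2_det]; exact Units.ne_zero _

lemma gl2_inv (g : GL (Fin 2) k) :
    g⁻¹ = mk2 (g 1 1 / (g 0 0 * g 1 1 - g 0 1 * g 1 0)) (-g 0 1 / (g 0 0 * g 1 1 - g 0 1 * g 1 0))
      (-g 1 0 / (g 0 0 * g 1 1 - g 0 1 * g 1 0)) (g 0 0 / (g 0 0 * g 1 1 - g 0 1 * g 1 0)) (by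
        have h := gl2_det_ne g
        have : g 1 1 / (g 0 0 * g 1 1 - g 0 1 * g 1 0) * (g 0 0 / (g 0 0 * g 1 1 - g 0 1 * g 1 0)) -
          -g 0 1 / (g 0 0 * g 1 1 - g 0 1 * g 1 0) * (-g 1 0 / (g 0 0 * g 1 1 - g 0 1 * g 1 0)) =
          (g 0 0 * g 1 1 - g 0 1 * g 1 0)⁻¹ := by field_simp
        rw [this]
        exact inv_ne_zero h) := by
  have h := gl2_det_ne g
  have h' := mul_inv_cancel₀ h
  rw [inv_eq_iff_mul_eq_one]
  apply gl2_ext <;> simp only [gl2_mul, mk2_00, mk2_01, mk2_10, mk2_11, gl2_one_00, gl2_one_01,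
    gl2_one_10, gl2_one_11, div_eq_mul_inv]
  · linear_combination h'
  · ring
  · ring
  · linear_combination h'

/-- The unramified principal series datum over a discretely valued field `k`. -/
structure Datum (k : Type) [Field k] (E : Type) [Field E] where
  v : AbsoluteValue k ℝ
  na : ∀ x y, v (x + y) ≤ max (v x) (v y)
  ϖ : kˣ
  ϖ_lt : v ϖ < 1
  disc : ∀ x, x ≠ 0 → ∃ j : ℤ, v x = v ϖ ^ j
  q : ℕ
  t : Fin q → k
  t_int : ∀ b, v (t b) ≤ 1
  t_sep : ∀ b b', b ≠ b' → v (t b - t b') = 1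
  t_cov : ∀ x, v x ≤ 1 → ∃ b, v (x - t b) ≤ v ϖ
  χ₁ : kˣ →* Eˣ
  χ₂ : kˣ →* Eˣ
  unr₁ : ∀ u : kˣ, v (u : k) = 1 → χ₁ u = 1
  unr₂ : ∀ u : kˣ, v (u : k) = 1 → χ₂ u = 1
  hne : χ₁ ϖ ≠ χ₂ ϖ

namespace Datum

variable {E : Type} [Field E] (D : Datum k E)

lemma ϖ_pos : 0 < D.v D.ϖ := D.v.pos (Units.ne_zero _)

lemma na_sub (x y : k) : D.v (x - y) ≤ max (D.v x) (D.v y) := by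
  rw [sub_eq_add_neg, ← D.v.map_neg y]; exact D.na _ _

lemma add_eq_of_lt {x y : k} (h : D.v x < D.v y) : D.v (x + y) = D.v y := by
  apply le_antisymm ((D.na _ _).trans (max_le h.le le_rfl))
  by_contra! h'
  have := D.na_sub (x + y) x
  rw [add_sub_cancel_left] at this
  exact absurd this (not_le.2 (max_lt h' h))

lemma lt_one_iff {x : k} : D.v x < 1 ↔ D.v x ≤ D.v D.ϖ := by
  refine ⟨fun h => ?_, fun h => h.trans_lt D.ϖ_lt⟩
  rcases eq_or_ne x 0 with rfl | hx
  · simp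
  obtain ⟨j, hj⟩ := D.disc x hx
  rw [hj] at h ⊢
  have hj : 1 ≤ j := by
    by_contra! hj
    exact absurd h (not_lt.2 (one_le_zpow_of_nonpos₀ D.ϖ_pos D.ϖ_lt.le (by omega)))
  simpa using zpow_le_zpow_right_of_le_one₀ D.ϖ_pos D.ϖ_lt.le hj

lemma lt_iff {x y : k} (hy : y ≠ 0) : D.v x < D.v y ↔ D.v x ≤ D.v D.ϖ * D.v y := by
  have hy' : 0 < D.v y := D.v.pos hy
  have := D.lt_one_iff (x := x / y)
  rwa [map_div₀, div_lt_one hy', div_le_iff₀ hy'] at this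

/-- The maximal compact subgroup `GL₂(𝒪)`. -/
def K : Subgroup (GL (Fin 2) k) where
  carrier := {g | (∀ i j, D.v (g i j) ≤ 1) ∧ D.v (g 0 0 * g 1 1 - g 0 1 * g 1 0) = 1}
  mul_mem' := by
    rintro g h ⟨hg, hg'⟩ ⟨hh, hh'⟩
    refine ⟨fun i j => ?_, ?_⟩
    · rw [gl2_mul]
      refine (D.na _ _).trans (max_le ?_ ?_) <;> rw [map_mul] <;>
        exact mul_le_one₀ (hg _ _) (D.v.nonneg _) (hh _ _)
    · rw [← gl2_det, map_mul, Units.val_mul, map_mul, gl2_det, gl2_det, hg', hh', one_mul]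
  one_mem' := by
    refine ⟨fun i j => ?_, by simp⟩
    fin_cases i <;> fin_cases j <;> simp
  inv_mem' := by
    rintro g ⟨hg, hg'⟩
    refine ⟨fun i j => ?_, ?_⟩
    · rw [gl2_inv]
      fin_cases i <;> fin_cases j <;> simp [hg', hg]
    · rw [← gl2_det, map_inv, Units.val_inv_eq_inv_val, map_inv₀, gl2_det, hg', inv_one]

lemma mem_K {g : GL (Fin 2) k} : g ∈ D.K ↔
    (∀ i j, D.v (g i j) ≤ 1) ∧ D.v (g 0 0 * g 1 1 - g 0 1 * g 1 0) = 1 := Iff.rfl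

/-- The matrix `diag(ϖ^s, 1)`. -/
def del (s : ℤ) : GL (Fin 2) k := mk2 ((D.ϖ : k) ^ s) 0 0 1 (by
  rw [mul_one, mul_zero, sub_zero]; exact zpow_ne_zero _ D.ϖ.ne_zero)

/-- The scalar matrix `ϖ^j`. -/
def scal (j : ℤ) : GL (Fin 2) k := mk2 ((D.ϖ : k) ^ j) 0 0 ((D.ϖ : k) ^ j) (by
  rw [mul_zero, sub_zero]; exact mul_ne_zero (zpow_ne_zero _ D.ϖ.ne_zero) (zpow_ne_zero _ D.ϖ.ne_zero))

/-- The upper triangular unipotent matrix. -/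
def upp (a : k) : GL (Fin 2) k := mk2 1 a 0 1 (by simp)

/-- The lower triangular unipotent matrix. -/
def low (a : k) : GL (Fin 2) k := mk2 1 0 a 1 (by simp)

/-- The permutation matrix. -/
def wey : GL (Fin 2) k := mk2 0 1 1 0 (by simp)

/-- The matrix with rows `ϖ, b` and `0, 1`. -/
def chd (b : k) : GL (Fin 2) k := mk2 D.ϖ b 0 1 (by simp)

lemma upp_mem {a : k} (ha : D.v a ≤ 1) : upp a ∈ D.K := by
  rw [mem_K]
  refine ⟨fun i j => ?_, by simp [upp]⟩
  fin_cases i <;> fin_cases j <;> simp [upp, ha]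

lemma low_mem {a : k} (ha : D.v a ≤ 1) : low a ∈ D.K := by
  rw [mem_K]
  refine ⟨fun i j => ?_, by simp [low]⟩
  fin_cases i <;> fin_cases j <;> simp [low, ha]

lemma wey_mem : wey ∈ D.K := by
  rw [mem_K]
  refine ⟨fun i j => ?_, by simp [wey]⟩
  fin_cases i <;> fin_cases j <;> simp [wey]

lemma del_add (s s' : ℤ) : D.del (s + s') = D.del s * D.del s' := by
  apply gl2_ext <;> simp [gl2_mul, del, zpow_add₀ D.ϖ.ne_zero]

lemma del_inv (s : ℤ) : (D.del s)⁻¹ = D.del (-s) := by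
  rw [inv_eq_iff_mul_eq_one, ← del_add, add_neg_cancel]
  apply gl2_ext <;> simp [del]

lemma conj_del_mem {g : GL (Fin 2) k} (hg : g ∈ D.K) (s : ℕ) (h : D.v (g 0 1) ≤ D.v D.ϖ ^ s) :
    (D.del s)⁻¹ * g * D.del s ∈ D.K := by
  have hp := pow_pos D.ϖ_pos s
  have hp1 := pow_le_one₀ (n := s) D.ϖ_pos.le D.ϖ_lt.le
  rw [D.mem_K] at hg ⊢
  refine ⟨fun i j => ?_, ?_⟩
  · rw [del_inv]
    fin_cases i <;> fin_cases j <;> simp [gl2_mul, del]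
    · rw [mul_right_comm, inv_mul_cancel₀ hp.ne', one_mul]; exact hg.1 0 0
    · rw [inv_mul_le_iff₀ hp]; simpa using h
    · exact mul_le_one₀ (hg.1 _ _) hp.le hp1
    · exact hg.1 _ _
  · rw [← gl2_det] at hg ⊢
    simpa using hg.2

lemma mul_entry_le {A B : Matrix (Fin 2) (Fin 2) k} {a b : ℝ} (ha : ∀ i j, D.v (A i j) ≤ a)
    (hb : ∀ i j, D.v (B i j) ≤ b) (i j : Fin 2) : D.v ((A * B) i j) ≤ a * b := by
  rw [Matrix.mul_apply, Fin.sum_univ_two]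
  have h0 : 0 ≤ a := (D.v.nonneg _).trans (ha 0 0)
  refine (D.na _ _).trans (max_le ?_ ?_) <;> rw [map_mul] <;>
    exact mul_le_mul (ha _ _) (hb _ _) (D.v.nonneg _) h0

/-- `h ≡ 1` modulo `ϖ^r`. -/
def Near (r : ℕ) (h : GL (Fin 2) k) : Prop :=
  ∀ i j : Fin 2, D.v (h i j - (1 : Matrix (Fin 2) (Fin 2) k) i j) ≤ D.v D.ϖ ^ r

lemma Near.mono {D : Datum k E} {r s : ℕ} (hrs : s ≤ r) {h : GL (Fin 2) k} (H : D.Near r h) :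
    D.Near s h := fun i j => (H i j).trans (pow_le_pow_of_le_one D.ϖ_pos.le D.ϖ_lt.le hrs)

lemma Near.mem_K {D : Datum k E} {r : ℕ} (hr : 1 ≤ r) {h : GL (Fin 2) k} (H : D.Near r h) :
    h ∈ D.K := by
  have H := H.mono hr
  rw [Near, pow_one] at H
  have hintegral : ∀ i j, D.v (h i j) ≤ 1 := by
    intro i j
    have h1 : D.v ((1 : Matrix (Fin 2) (Fin 2) k) i j) ≤ 1 := by
      fin_cases i <;> fin_cases j <;> simp
    have := D.na (h i j - (1 : Matrix (Fin 2) (Fin 2) k) i j) ((1 : Matrix (Fin 2) (Fin 2) k) i j)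
    rw [sub_add_cancel] at this
    exact this.trans (max_le ((H i j).trans D.ϖ_lt.le) h1)
  refine ⟨hintegral, ?_⟩
  have e : h 0 0 * h 1 1 - h 0 1 * h 1 0 =
    ((h 0 0 - 1) * h 1 1 + ((h 1 1 - 1) - h 0 1 * h 1 0)) + 1 := by ring
  have h00 := H 0 0
  have h01 := H 0 1
  have h10 := H 1 0
  have h11 := H 1 1
  simp at h00 h01 h10 h11
  rw [e, D.add_eq_of_lt] <;> rw [map_one]
  refine (D.na _ _).trans_lt (max_lt ?_ ((D.na_sub _ _).trans_lt (max_lt ?_ ?_)))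
  · rw [map_mul]
    exact (mul_le_of_le_one_right (D.v.nonneg _) (hintegral _ _)).trans_lt (h00.trans_lt D.ϖ_lt)
  · exact h11.trans_lt D.ϖ_lt
  · rw [map_mul]
    exact (mul_le_of_le_one_right (D.v.nonneg _) (hintegral _ _)).trans_lt (h01.trans_lt D.ϖ_lt)

lemma conj_entry (g h : GL (Fin 2) k) : ((g⁻¹ * h * g : GL (Fin 2) k) : Matrix (Fin 2) (Fin 2) k) - 1 =
    (g⁻¹ : GL (Fin 2) k).1 * (h.1 - 1) * g.1 := by
  rw [mul_sub, sub_mul, mul_one, ← Units.val_mul g⁻¹ g, inv_mul_cancel]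
  rfl

lemma exists_near_conj (g : GL (Fin 2) k) (s : ℕ) :
    ∃ r, ∀ h, D.Near r h → D.Near s (g⁻¹ * h * g) := by
  obtain ⟨a, ha⟩ : ∃ a, ∀ i j, D.v (g i j) ≤ a := by
    obtain ⟨a, ha⟩ := (Set.finite_range (fun p : Fin 2 × Fin 2 => D.v (g p.1 p.2))).bddAbove
    exact ⟨a, fun i j => ha ⟨(i, j), rfl⟩⟩
  obtain ⟨b, hb⟩ : ∃ a, ∀ i j, D.v (g⁻¹ i j) ≤ a := by
    obtain ⟨a, ha⟩ := (Set.finite_range (fun p : Fin 2 × Fin 2 => D.v (g⁻¹ p.1 p.2))).bddAbove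
    exact ⟨a, fun i j => ha ⟨(i, j), rfl⟩⟩
  have ha0 : 0 ≤ a := (D.v.nonneg _).trans (ha 0 0)
  have hb0 : 0 ≤ b := (D.v.nonneg _).trans (hb 0 0)
  have hp := pow_pos D.ϖ_pos s
  obtain ⟨r, hr⟩ := exists_pow_lt_of_lt_one (y := D.v D.ϖ) (x := D.v D.ϖ ^ s / (b * a + 1))
    (by positivity) D.ϖ_lt
  refine ⟨r, fun h hh i j => ?_⟩
  have := D.mul_entry_le (D.mul_entry_le hb hh) ha i j
  have e := congrFun (congrFun (conj_entry g h) i) j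
  rw [Matrix.sub_apply] at e
  erw [e]
  refine this.trans ?_
  rw [lt_div_iff₀ (by positivity)] at hr
  nlinarith [pow_pos D.ϖ_pos r]

lemma conj_near_mem {κ h : GL (Fin 2) k} (hκ : κ ∈ D.K) {r s : ℕ} (hr : 1 ≤ r) (hs : s ≤ r)
    (hh : D.Near r h) : (κ * D.del s)⁻¹ * h * (κ * D.del s) ∈ D.K := by
  have e : (κ * D.del s)⁻¹ * h * (κ * D.del s) = (D.del s)⁻¹ * (κ⁻¹ * h * κ) * D.del s := by group
  rw [e]
  apply D.conj_del_mem (D.K.mul_mem (D.K.mul_mem (D.K.inv_mem hκ) (hh.mem_K hr)) hκ)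
  have := D.mul_entry_le (D.mul_entry_le (D.K.inv_mem hκ).1 hh) hκ.1 0 1
  have e := congrFun (congrFun (conj_entry κ h) 0) 1
  rw [Matrix.sub_apply] at e
  have e2 : (κ⁻¹ * h * κ) 0 1 = ((κ⁻¹ : GL (Fin 2) k).1 * (h.1 - 1) * κ.1) 0 1 := by
    rw [← e]; simp
  rw [e2]
  rw [one_mul, mul_one] at this
  exact this.trans (pow_le_pow_of_le_one D.ϖ_pos.le D.ϖ_lt.le hs)


/-- The character `χ₂ / χ₁`. -/
def χ : kˣ →* Eˣ := D.χ₂ / D.χ₁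

/-- The character `χ₂ / χ₁` as a function of the absolute value. -/
def th (r : ℝ) : E := if h : ∃ u : kˣ, D.v u = r then (D.χ h.choose : E) else 0

/-- The value `χ₂(ϖ) / χ₁(ϖ)`. -/
def θ : E := D.χ D.ϖ

lemma χ_unr (u : kˣ) (hu : D.v (u : k) = 1) : D.χ u = 1 := by
  rw [χ, MonoidHom.div_apply, D.unr₁ u hu, D.unr₂ u hu, div_one]

lemma θ_ne_one : D.θ ≠ 1 := by
  intro h
  rw [θ, Units.val_eq_one, χ, MonoidHom.div_apply, div_eq_one] at h
  exact D.hne h.symm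

lemma θ_eq : D.θ * (D.χ₁ D.ϖ : E) = D.χ₂ D.ϖ := by
  rw [θ, χ, MonoidHom.div_apply, ← Units.val_mul, div_mul_cancel]

lemma th_v (u : kˣ) : D.th (D.v u) = D.χ u := by
  have h : ∃ w : kˣ, D.v w = D.v u := ⟨u, rfl⟩
  rw [th, dif_pos h]
  have : D.χ (h.choose / u) = 1 := D.χ_unr _ (by
    rw [Units.val_div_eq_div_val, map_div₀, h.choose_spec, div_self (D.v.ne_zero u.ne_zero)])
  rw [map_div, div_eq_one] at this
  rw [this]

lemma th_mul (u w : kˣ) : D.th (D.v u * D.v w) = D.χ u * D.th (D.v w) := by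
  rw [← map_mul, ← Units.val_mul, th_v, th_v, map_mul, Units.val_mul]

/-- The norm of the bottom row. -/
def rowNorm (x : GL (Fin 2) k) : ℝ := max (D.v (x 1 0)) (D.v (x 1 1))

lemma exists_rowNorm (x : GL (Fin 2) k) : ∃ w : kˣ, D.v w = D.rowNorm x := by
  have h := gl2_det_ne x
  rcases le_total (D.v (x 1 0)) (D.v (x 1 1)) with h' | h'
  · refine ⟨Units.mk0 (x 1 1) ?_, (max_eq_right h').symm⟩
    intro h0
    rw [h0, map_zero] at h'
    have := D.v.eq_zero.1 (le_antisymm h' (D.v.nonneg _))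
    simp [h0, this] at h
  · refine ⟨Units.mk0 (x 1 0) ?_, (max_eq_left h').symm⟩
    intro h0
    rw [h0, map_zero] at h'
    have := D.v.eq_zero.1 (le_antisymm h' (D.v.nonneg _))
    simp [h0, this] at h

lemma rowNorm_mul_le (x : GL (Fin 2) k) {κ : GL (Fin 2) k} (hκ : κ ∈ D.K) :
    D.rowNorm (x * κ) ≤ D.rowNorm x := by
  have key : ∀ j, D.v ((x * κ) 1 j) ≤ D.rowNorm x := fun j => by
    rw [gl2_mul]
    refine (D.na _ _).trans (max_le_max ?_ ?_) <;> rw [map_mul] <;>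
      exact mul_le_of_le_one_right (D.v.nonneg _) (hκ.1 _ _)
  exact max_le (key 0) (key 1)

lemma rowNorm_mul (x : GL (Fin 2) k) {κ : GL (Fin 2) k} (hκ : κ ∈ D.K) :
    D.rowNorm (x * κ) = D.rowNorm x := by
  refine le_antisymm (D.rowNorm_mul_le x hκ) ?_
  have := D.rowNorm_mul_le (x * κ) (D.K.inv_mem hκ)
  rwa [mul_inv_cancel_right] at this

/-- The spherical vector of the induced representation. -/
def phi (x : GL (Fin 2) k) : E :=
  (D.χ₁ (Matrix.GeneralLinearGroup.det x) : E) * D.th (D.rowNorm x)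

lemma phi_mul_K (x : GL (Fin 2) k) {κ : GL (Fin 2) k} (hκ : κ ∈ D.K) :
    D.phi (x * κ) = D.phi x := by
  rw [phi, phi, D.rowNorm_mul x hκ, map_mul, map_mul, D.unr₁ (Matrix.GeneralLinearGroup.det κ), mul_one]
  rw [gl2_det]
  exact hκ.2

lemma phi_borel (b x : GL (Fin 2) k) (hb : b 1 0 = 0) (u₁ u₂ : kˣ) (h₁ : b 0 0 = u₁)
    (h₂ : b 1 1 = u₂) : D.phi (b * x) = D.χ₁ u₁ * D.χ₂ u₂ * D.phi x := by
  have hdet : Matrix.GeneralLinearGroup.det b = u₁ * u₂ := by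
    apply Units.ext
    rw [gl2_det, hb, h₁, h₂, mul_zero, sub_zero, Units.val_mul]
  have hrow : D.rowNorm (b * x) = D.v u₂ * D.rowNorm x := by
    simp only [rowNorm, gl2_mul, hb, h₂, zero_mul, zero_add, map_mul]
    rw [mul_max_of_nonneg _ _ (D.v.nonneg _)]
  obtain ⟨w, hw⟩ := D.exists_rowNorm x
  rw [phi, phi, hrow, ← hw, th_mul, map_mul, hdet, map_mul, χ, MonoidHom.div_apply]
  have : (D.χ₂ u₂ : E) = D.χ₁ u₂ * (D.χ₂ u₂ / D.χ₁ u₂ : Eˣ) := by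
    rw [← Units.val_mul, mul_div_cancel]
  rw [this, map_mul, Units.val_mul, Units.val_mul]
  ring

lemma phi_scal (j : ℤ) (x : GL (Fin 2) k) :
    D.phi (D.scal j * x) = ((D.χ₁ D.ϖ * D.χ₂ D.ϖ) ^ j : Eˣ) * D.phi x := by
  rw [D.phi_borel (D.scal j) x rfl (D.ϖ ^ j) (D.ϖ ^ j) (by simp [scal]) (by simp [scal]), map_zpow,
    map_zpow, mul_zpow, Units.val_mul]

lemma det_chd (b : k) : Matrix.GeneralLinearGroup.det (D.chd b) = D.ϖ := by
  apply Units.ext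
  rw [gl2_det]
  simp [chd]

lemma det_del (s : ℤ) : Matrix.GeneralLinearGroup.det (D.del s) = D.ϖ ^ s := by
  apply Units.ext
  rw [gl2_det]
  simp [del]

lemma sum_th (c d : k) (h : c ≠ 0 ∨ d ≠ 0) :
    ∑ b, D.th (max (D.v (c * D.ϖ)) (D.v (c * D.t b + d))) =
      (D.θ + D.q) * D.th (max (D.v c) (D.v d)) - D.θ * D.th (max (D.v (c * (D.ϖ : k)⁻¹)) (D.v d)) := by
  have hϖ := D.ϖ_pos
  rcases lt_or_ge (D.v c) (D.v d) with hcd | hcd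
  · have hd : d ≠ 0 := by
      rintro rfl
      exact absurd hcd (by simp [D.v.nonneg])
    have hcd' := (D.lt_iff hd).1 hcd
    have e1 : ∀ b, max (D.v (c * D.ϖ)) (D.v (c * D.t b + d)) = D.v d := fun b => by
      rw [D.add_eq_of_lt, max_eq_right]
      · rw [map_mul]
        exact (mul_le_of_le_one_right (D.v.nonneg _) D.ϖ_lt.le).trans hcd.le
      · rw [map_mul]
        exact (mul_le_of_le_one_right (D.v.nonneg _) (D.t_int b)).trans_lt hcd
    have e2 : max (D.v (c * (D.ϖ : k)⁻¹)) (D.v d) = D.v d := by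
      apply max_eq_right
      rw [map_mul, map_inv₀, mul_inv_le_iff₀ hϖ, mul_comm]
      exact hcd'
    simp only [e1, e2, max_eq_right hcd.le]
    rw [Finset.sum_const, Finset.card_univ, Fintype.card_fin, nsmul_eq_mul]
    ring
  · have hc : c ≠ 0 := by
      rintro rfl
      rw [map_zero] at hcd
      have := D.v.eq_zero.1 (le_antisymm hcd (D.v.nonneg _))
      simp [this] at h
    have hc' := D.v.pos hc
    obtain ⟨b₀, hb₀⟩ := D.t_cov (-d / c) (by rw [map_div₀, D.v.map_neg]; exact div_le_one_of_le₀ hcd hc'.le)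
    have e0 : D.v (c * D.t b₀ + d) ≤ D.v (c * D.ϖ) := by
      have : c * D.t b₀ + d = - (c * (-d / c - D.t b₀)) := by field_simp; ring
      rw [this, D.v.map_neg, map_mul, map_mul]
      exact mul_le_mul_of_nonneg_left hb₀ hc'.le
    have e1 : ∀ b ∈ Finset.univ.erase b₀,
        D.th (max (D.v (c * D.ϖ)) (D.v (c * D.t b + d))) = D.th (D.v c) := fun b hb => by
      have hlt : D.v (c * D.ϖ) < D.v c := by
        rw [map_mul]; exact mul_lt_of_lt_one_right hc' D.ϖ_lt
      have hs : D.v (c * (D.t b - D.t b₀)) = D.v c := by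
        rw [map_mul, D.t_sep b b₀ (Finset.ne_of_mem_erase hb), mul_one]
      have : c * D.t b + d = (c * D.t b₀ + d) + c * (D.t b - D.t b₀) := by ring
      rw [this, D.add_eq_of_lt, hs, max_eq_right hlt.le]
      rw [hs]
      exact e0.trans_lt hlt
    have hq : 1 ≤ D.q := Nat.one_le_iff_ne_zero.2 (by
      intro h0
      exact (Fin.cast h0 b₀).elim0)
    rw [← Finset.add_sum_erase _ _ (Finset.mem_univ b₀), Finset.sum_congr rfl e1, max_eq_left e0,
      Finset.sum_const, Finset.card_erase_of_mem (Finset.mem_univ _), Finset.card_univ,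
      Fintype.card_fin, nsmul_eq_mul, max_eq_left hcd, max_eq_left, Nat.cast_sub hq]
    · have t1 : D.th (D.v (c * D.ϖ)) = D.θ * D.th (D.v c) := by
        rw [mul_comm, map_mul, θ]
        exact D.th_mul D.ϖ (Units.mk0 c hc)
      have t2 : D.th (D.v c) = D.θ * D.th (D.v (c * (D.ϖ : k)⁻¹)) := by
        have := D.th_mul D.ϖ (Units.mk0 c hc * D.ϖ⁻¹)
        rw [← map_mul] at this
        have e : (D.ϖ : k) * ((Units.mk0 c hc * D.ϖ⁻¹ : kˣ) : k) = c := by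
          rw [Units.val_mul, Units.val_mk0, mul_comm, mul_assoc, Units.inv_mul, mul_one]
        rw [e] at this
        simpa [θ] using this
      rw [t1, ← t2]
      push_cast
      ring
    · refine hcd.trans ?_
      rw [map_mul, map_inv₀]
      exact le_mul_of_one_le_right hc'.le ((one_le_inv₀ hϖ).2 D.ϖ_lt.le)

lemma sum_phi (x : GL (Fin 2) k) :
    ∑ b, D.phi (x * D.chd (D.t b)) = (D.θ + D.q) * D.χ₁ D.ϖ * D.phi x -
      D.θ * (D.χ₁ D.ϖ) ^ 2 * D.phi (x * D.del (-1)) := by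
  have h : x 1 0 ≠ 0 ∨ x 1 1 ≠ 0 := by
    by_contra! h
    have := gl2_det_ne x
    simp [h.1, h.2] at this
  have key := D.sum_th _ _ h
  have e1 : ∀ b, D.phi (x * D.chd (D.t b)) = D.χ₁ (Matrix.GeneralLinearGroup.det x) * D.χ₁ D.ϖ *
      D.th (max (D.v (x 1 0 * D.ϖ)) (D.v (x 1 0 * D.t b + x 1 1))) := fun b => by
    rw [phi, map_mul, det_chd, map_mul, rowNorm, gl2_mul, gl2_mul]
    simp [chd]
  have e2 : D.phi (x * D.del (-1)) = D.χ₁ (Matrix.GeneralLinearGroup.det x) * (D.χ₁ D.ϖ : E)⁻¹ *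
      D.th (max (D.v (x 1 0 * (D.ϖ : k)⁻¹)) (D.v (x 1 1))) := by
    rw [phi, map_mul, det_del, map_mul, rowNorm, gl2_mul, gl2_mul]
    simp [del]
  simp only [e1, ← Finset.mul_sum]
  rw [key, e2, phi, rowNorm]
  have := (D.χ₁ D.ϖ).ne_zero
  field_simp

lemma scal_comm (j : ℤ) (x : GL (Fin 2) k) : x * D.scal j = D.scal j * x := by
  apply gl2_ext <;> simp [gl2_mul, scal, mul_comm]

lemma wey_mul_wey : (wey * wey : GL (Fin 2) k) = 1 := by
  apply gl2_ext <;> simp [gl2_mul, wey]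

lemma exists_cartan_of_le (g : GL (Fin 2) k) (h : ∀ i j, D.v (g i j) ≤ D.v (g 1 1)) :
    ∃ j : ℤ, ∃ κ ∈ D.K, ∃ r : ℕ, ∃ κ' ∈ D.K, g = D.scal j * (κ * D.del r) * κ' := by
  have hd : g 1 1 ≠ 0 := by
    intro h0
    have h1 := h 1 0
    rw [h0, map_zero] at h1
    have := gl2_det_ne g
    simp [h0, D.v.eq_zero.1 (le_antisymm h1 (D.v.nonneg _))] at this
  have hd' := D.v.pos hd
  obtain ⟨j, hj⟩ := D.disc _ hd
  have hintegral : ∀ i l, D.v ((D.ϖ : k) ^ (-j) * g i l) ≤ 1 := fun i l => by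
    rw [map_mul, map_zpow₀, _root_.zpow_neg, ← hj, inv_mul_le_iff₀ hd', mul_one]
    exact h i l
  have hdu : D.v ((D.ϖ : k) ^ (-j) * g 1 1) = 1 := by
    rw [map_mul, map_zpow₀, _root_.zpow_neg, ← hj, inv_mul_cancel₀ hd'.ne']
  set z := (D.ϖ : k) ^ (-j) with hz
  have hz0 : z ≠ 0 := zpow_ne_zero _ D.ϖ.ne_zero
  have hzj : (D.ϖ : k) ^ j * z = 1 := by
    rw [hz, _root_.zpow_neg, mul_inv_cancel₀ (zpow_ne_zero _ D.ϖ.ne_zero)]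
  set e := z * (g 0 0 - g 0 1 * g 1 0 / g 1 1) with he
  have he0 : e ≠ 0 := by
    refine mul_ne_zero hz0 ?_
    have := gl2_det_ne g
    intro h0
    apply this
    field_simp at h0
    simpa using h0
  have hbd : D.v (g 0 1 / g 1 1) ≤ 1 := by
    rw [map_div₀]; exact div_le_one_of_le₀ (h _ _) hd'.le
  have hee : e = z * g 0 0 - (g 0 1 / g 1 1) * (z * g 1 0) := by rw [he]; ring
  have he1 : D.v e ≤ 1 := by
    rw [hee]
    refine (D.na_sub _ _).trans (max_le (hintegral _ _) ?_)
    rw [map_mul]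
    exact mul_le_one₀ hbd (D.v.nonneg _) (hintegral _ _)
  obtain ⟨i, hi⟩ := D.disc e he0
  have hi0 : 0 ≤ i := by
    by_contra! hi0
    rw [hi] at he1
    have := one_lt_zpow_of_neg₀ D.ϖ_pos D.ϖ_lt hi0
    linarith
  lift i to ℕ using hi0
  have hϖi : (D.ϖ : k) ^ i ≠ 0 := pow_ne_zero _ D.ϖ.ne_zero
  have hu : D.v (e / (D.ϖ : k) ^ i) = 1 := by
    rw [map_div₀, hi, map_pow, zpow_natCast, div_self (pow_ne_zero _ D.ϖ_pos.ne')]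
  refine ⟨j, upp (g 0 1 / g 1 1), D.upp_mem hbd, i,
    mk2 (e / (D.ϖ : k) ^ i) 0 (z * g 1 0) (z * g 1 1) ?_, ⟨?_, ?_⟩, ?_⟩
  · rw [zero_mul, sub_zero]
    exact mul_ne_zero (div_ne_zero he0 hϖi) (mul_ne_zero hz0 hd)
  · intro a b
    fin_cases a <;> fin_cases b
    · exact hu.le
    · simp
    · exact hintegral _ _
    · exact hintegral _ _
  · simp only [mk2_00, mk2_01, mk2_10, mk2_11, zero_mul, sub_zero]
    rw [map_mul, hu, hdu, one_mul]
  · apply gl2_ext <;> simp [gl2_mul, scal, upp, del]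
    · field_simp
      rw [hee]
      field_simp
      linear_combination (-g 0 0 * g 1 1) * hzj
    · field_simp
      linear_combination (-g 0 1) * hzj
    · linear_combination (-g 1 0) * hzj
    · linear_combination (-g 1 1) * hzj

lemma wey_mul_zero (g : GL (Fin 2) k) (l : Fin 2) : (wey * g : GL (Fin 2) k) 0 l = g 1 l := by
  simp [gl2_mul, wey]

lemma wey_mul_one (g : GL (Fin 2) k) (l : Fin 2) : (wey * g : GL (Fin 2) k) 1 l = g 0 l := by
  simp [gl2_mul, wey]

lemma mul_wey_zero (g : GL (Fin 2) k) (l : Fin 2) : (g * wey : GL (Fin 2) k) l 0 = g l 1 := by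
  simp [gl2_mul, wey]

lemma mul_wey_one (g : GL (Fin 2) k) (l : Fin 2) : (g * wey : GL (Fin 2) k) l 1 = g l 0 := by
  simp [gl2_mul, wey]

lemma exists_cartan (g : GL (Fin 2) k) :
    ∃ j : ℤ, ∃ κ ∈ D.K, ∃ r : ℕ, ∃ κ' ∈ D.K, g = D.scal j * (κ * D.del r) * κ' := by
  have left : ∀ g : GL (Fin 2) k,
      (∃ j : ℤ, ∃ κ ∈ D.K, ∃ r : ℕ, ∃ κ' ∈ D.K, wey * g = D.scal j * (κ * D.del r) * κ') →
      ∃ j : ℤ, ∃ κ ∈ D.K, ∃ r : ℕ, ∃ κ' ∈ D.K, g = D.scal j * (κ * D.del r) * κ' := by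
    rintro g ⟨j, κ, hκ, r, κ', hκ', e⟩
    refine ⟨j, wey * κ, D.K.mul_mem D.wey_mem hκ, r, κ', hκ', ?_⟩
    rw [← one_mul g, ← wey_mul_wey, mul_assoc, e]
    simp only [← mul_assoc]
    rw [D.scal_comm j wey]
  have right : ∀ g : GL (Fin 2) k,
      (∃ j : ℤ, ∃ κ ∈ D.K, ∃ r : ℕ, ∃ κ' ∈ D.K, g * wey = D.scal j * (κ * D.del r) * κ') →
      ∃ j : ℤ, ∃ κ ∈ D.K, ∃ r : ℕ, ∃ κ' ∈ D.K, g = D.scal j * (κ * D.del r) * κ' := by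
    rintro g ⟨j, κ, hκ, r, κ', hκ', e⟩
    refine ⟨j, κ, hκ, r, κ' * wey, D.K.mul_mem hκ' D.wey_mem, ?_⟩
    rw [← mul_assoc, ← e, mul_assoc, wey_mul_wey, mul_one]
  obtain ⟨⟨a, b⟩, hab⟩ := Finite.exists_max (fun p : Fin 2 × Fin 2 => D.v (g p.1 p.2))
  have hab : ∀ i j, D.v (g i j) ≤ D.v (g a b) := fun i j => hab (i, j)
  fin_cases a <;> fin_cases b
  · refine left _ (right _ (D.exists_cartan_of_le _ fun i j => ?_))
    fin_cases i <;> fin_cases j <;> simp only [Fin.zero_eta, Fin.mk_one, mul_wey_zero, mul_wey_one, wey_mul_zero,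
      wey_mul_one] <;>
      exact hab _ _
  · refine left _ (D.exists_cartan_of_le _ fun i j => ?_)
    fin_cases i <;> simp only [Fin.zero_eta, Fin.mk_one, wey_mul_zero,
      wey_mul_one] <;> exact hab _ _
  · refine right _ (D.exists_cartan_of_le _ fun i j => ?_)
    fin_cases j <;> simp only [Fin.zero_eta, Fin.mk_one, mul_wey_zero, mul_wey_one] <;> exact hab _ _
  · exact D.exists_cartan_of_le _ hab

lemma exists_iwasawa (g : GL (Fin 2) k) : ∃ b : GL (Fin 2) k, b 1 0 = 0 ∧ ∃ x, D.v x ≤ 1 ∧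
    (g = b * low x ∨ g = b * (wey * upp x)) := by
  have h := gl2_det_ne g
  rcases le_total (D.v (g 1 0)) (D.v (g 1 1)) with h' | h'
  · have hd : g 1 1 ≠ 0 := by
      intro h0
      rw [h0, map_zero] at h'
      simp [h0, D.v.eq_zero.1 (le_antisymm h' (D.v.nonneg _))] at h
    refine ⟨g * low (-(g 1 0 / g 1 1)), ?_, g 1 0 / g 1 1, ?_, Or.inl ?_⟩
    · simp only [gl2_mul, low, mk2_00, mk2_10]
      field_simp
      ring
    · rw [map_div₀]; exact div_le_one_of_le₀ h' (D.v.nonneg _)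
    · have : (low (-(g 1 0 / g 1 1)) * low (g 1 0 / g 1 1) : GL (Fin 2) k) = 1 := by
        apply gl2_ext <;> simp [gl2_mul, low]
      rw [mul_assoc, this, mul_one]
  · have hc : g 1 0 ≠ 0 := by
      intro h0
      rw [h0, map_zero] at h'
      simp [h0, D.v.eq_zero.1 (le_antisymm h' (D.v.nonneg _))] at h
    refine ⟨g * upp (-(g 1 1 / g 1 0)) * wey, ?_, g 1 1 / g 1 0, ?_, Or.inr ?_⟩
    · simp [gl2_mul, upp, wey]
      field_simp
      ring
    · rw [map_div₀]; exact div_le_one_of_le₀ h' (D.v.nonneg _)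
    · have : (upp (-(g 1 1 / g 1 0)) * upp (g 1 1 / g 1 0) : GL (Fin 2) k) = 1 := by
        apply gl2_ext <;> simp [gl2_mul, upp]
      rw [mul_assoc, ← mul_assoc wey, wey_mul_wey, one_mul, mul_assoc, this, mul_one]

end Datum
end Group

section Coefficients

open Polynomial

variable {E : Type} [Field E] {abs : AbsoluteValue E ℝ}
  (na : ∀ x y : E, abs (x + y) ≤ max (abs x) (abs y))

include na in
lemma abs_sum_le {ι : Type} (s : Finset ι) (f : ι → E) {ε : ℝ} (hε : 0 ≤ ε)
    (h : ∀ i ∈ s, abs (f i) ≤ ε) : abs (∑ i ∈ s, f i) ≤ ε :=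
  Finset.sum_induction f (fun x => abs x ≤ ε) (fun _ _ ha hb => (na _ _).trans (max_le ha hb))
    (by simpa using hε) h

/-- All coefficients of `P` have absolute value at most `ε`. -/
def Bd (abs : AbsoluteValue E ℝ) (ε : ℝ) (P : E[X]) : Prop := ∀ i, abs (P.coeff i) ≤ ε

lemma Bd.nonneg {ε : ℝ} {P : E[X]} (h : Bd abs ε P) : 0 ≤ ε := (abs.nonneg _).trans (h 0)

lemma Bd.mono {ε δ : ℝ} {P : E[X]} (h : Bd abs ε P) (hεδ : ε ≤ δ) : Bd abs δ P :=
  fun i => (h i).trans hεδ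

include na in
lemma Bd.add {ε : ℝ} {P Q : E[X]} (hP : Bd abs ε P) (hQ : Bd abs ε Q) : Bd abs ε (P + Q) :=
  fun i => by
    rw [coeff_add]
    exact (na _ _).trans (max_le (hP i) (hQ i))

lemma Bd.zero {ε : ℝ} (hε : 0 ≤ ε) : Bd abs ε (0 : E[X]) := fun i => by simpa using hε

include na in
lemma Bd.sum {ι : Type} {s : Finset ι} {f : ι → E[X]} {ε : ℝ} (hε : 0 ≤ ε)
    (h : ∀ i ∈ s, Bd abs ε (f i)) : Bd abs ε (∑ i ∈ s, f i) :=
  Finset.sum_induction f (Bd abs ε) (fun _ _ ha hb => ha.add na hb) (Bd.zero hε) h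

lemma Bd.smul {ε : ℝ} {P : E[X]} (c : E) (hP : Bd abs ε P) : Bd abs (abs c * ε) (c • P) :=
  fun i => by
    rw [coeff_smul, smul_eq_mul, map_mul]
    exact mul_le_mul_of_nonneg_left (hP i) (abs.nonneg _)

include na in
lemma Bd.mul {ε δ : ℝ} {P Q : E[X]} (hP : Bd abs ε P) (hQ : Bd abs δ Q) :
    Bd abs (ε * δ) (P * Q) := fun i => by
  rw [coeff_mul]
  refine abs_sum_le na _ _ (mul_nonneg hP.nonneg hQ.nonneg) fun p _ => ?_
  rw [map_mul]
  exact mul_le_mul (hP _) (hQ _) (abs.nonneg _) hP.nonneg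

lemma Bd.C {ε : ℝ} {c : E} (h : abs c ≤ ε) : Bd abs ε (C c) := fun i => by
  rw [coeff_C]
  split_ifs
  · exact h
  · simpa using (abs.nonneg _).trans h

lemma Bd.X : Bd abs 1 (X : E[X]) := fun i => by
  rw [coeff_X]
  split_ifs <;> simp

include na in
lemma Bd.pow {P : E[X]} (hP : Bd abs 1 P) (i : ℕ) : Bd abs 1 (P ^ i) := by
  induction i with
  | zero => rw [pow_zero, ← C_1]; exact Bd.C (by simp)
  | succ i ih => simpa [pow_succ] using ih.mul na hP

include na in
lemma Bd.prod {ι : Type} {s : Finset ι} {f : ι → E[X]}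
    (h : ∀ i ∈ s, Bd abs 1 (f i)) : Bd abs 1 (∏ i ∈ s, f i) :=
  Finset.prod_induction f (Bd abs 1) (fun _ _ ha hb => by simpa using ha.mul na hb)
    (by rw [← C_1]; exact Bd.C (by simp)) h

include na in
/-- A polynomial of degree less than the number of nodes, with nodes integral and distinct in the
residue field, is bounded by its values at the nodes. -/
lemma Bd.of_eval {q : ℕ} {x : Fin q → E} (hx : ∀ b, abs (x b) ≤ 1)
    (hsep : ∀ b b', b ≠ b' → abs (x b - x b') = 1) {P : E[X]} {n : ℕ} (hn : n < q)
    (hP : P.degree ≤ n) {ε : ℝ} (h : ∀ b, abs (P.eval (x b)) ≤ ε) : Bd abs ε P := by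
  have hinj : Set.InjOn x (Finset.univ : Finset (Fin q)) := by
    intro b _ b' _ hb
    by_contra hne
    have := hsep b b' hne
    rw [hb, sub_self, map_zero] at this
    exact zero_ne_one this
  have hε : 0 ≤ ε := (abs.nonneg _).trans (h ⟨0, by omega⟩)
  rw [Lagrange.eq_interpolate (s := Finset.univ) hinj (f := P) (by
    rw [Finset.card_univ, Fintype.card_fin]
    exact hP.trans_lt (by exact_mod_cast hn)), Lagrange.interpolate_apply]
  refine Bd.sum na hε fun b _ => ?_
  rw [← mul_one ε]
  refine (Bd.C (h b)).mul na (Bd.prod na fun b' hb' => ?_)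
  rw [Lagrange.basisDivisor, ← one_mul (1 : ℝ)]
  refine (Bd.C ?_).mul na ?_
  · rw [map_inv₀, hsep _ _ (Finset.ne_of_mem_erase hb').symm, inv_one]
  · rw [sub_eq_add_neg, ← C_neg]
    exact Bd.X.add na (Bd.C (by rw [abs.map_neg]; exact hx _))

end Coefficients

section Rep

open Polynomial

/-- The parameters of the locally algebraic representation, with the Breuil–Schneider
conditions. -/
structure RepDatum (E : Type) [Field E] where
  abs : AbsoluteValue E ℝ
  na : ∀ x y : E, abs (x + y) ≤ max (abs x) (abs y)
  F : Subfield E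
  D : Datum F E
  hv : ∀ x : F, D.v x = abs (x : E)
  m : ℤ
  n : ℕ
  hn : n < D.q
  bs_eq : abs (D.χ₁ D.ϖ * D.χ₂ D.ϖ * (((D.ϖ : F) : E) ^ (2 * m + n))) = 1
  bs_le : abs ((D.χ₂ D.ϖ + D.q * D.χ₁ D.ϖ) * (((D.ϖ : F) : E) ^ (m + n))) ≤ 1

namespace RepDatum

variable {E : Type} [Field E] (R : RepDatum E)

/-- The algebraic representation, as a linear map. -/
def tau (g : GL (Fin 2) R.F) : E[X] →ₗ[E] E[X] where
  toFun := tauPoly E R.m R.n (matE E R.F g)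
  map_add' P Q := by
    simp only [tauPoly, coeff_add, add_smul, Finset.sum_add_distrib, smul_add]
  map_smul' c P := by
    simp only [tauPoly, coeff_smul, smul_eq_mul, mul_smul, ← Finset.smul_sum, RingHom.id_apply]
    rw [smul_comm]

/-- The determinant of a matrix, as an element of `E`. -/
def dt (g : GL (Fin 2) R.F) : E := (g 0 0 : E) * (g 1 1 : E) - (g 0 1 : E) * (g 1 0 : E)

lemma dt_eq (g : GL (Fin 2) R.F) :
    R.dt g = ((g 0 0 * g 1 1 - g 0 1 * g 1 0 : R.F) : E) := by
  push_cast [dt]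
  rfl

lemma dt_mul (g h : GL (Fin 2) R.F) : R.dt (g * h) = R.dt g * R.dt h := by
  simp only [dt, gl2_mul]
  push_cast
  ring

lemma tau_apply (g : GL (Fin 2) R.F) (P : E[X]) : R.tau g P = (R.dt g ^ R.m) •
    ∑ i ∈ Finset.range (R.n + 1), P.coeff i •
      ((C (g 0 0 : E) + C (g 1 0 : E) * X) ^ (R.n - i) *
       (C (g 0 1 : E) + C (g 1 1 : E) * X) ^ i) := rfl

lemma degree_tau_le (g : GL (Fin 2) R.F) (P : E[X]) : (R.tau g P).degree ≤ R.n := by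
  rw [tau_apply, ← natDegree_le_iff_degree_le]
  refine (natDegree_smul_le _ _).trans (natDegree_sum_le_of_forall_le _ _ fun i hi => ?_)
  refine (natDegree_smul_le _ _).trans (natDegree_mul_le.trans ?_)
  have h1 : ∀ a b : E, (C a + C b * X).natDegree ≤ 1 := fun a b => by
    rw [add_comm]; exact natDegree_linear_le
  have hi := Finset.mem_range.1 hi
  have e1 := natDegree_pow_le_of_le (R.n - i) (h1 (g 0 0) (g 1 0))
  have e2 := natDegree_pow_le_of_le i (h1 (g 0 1) (g 1 1))
  rw [mul_one] at e1 e2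
  omega

lemma eval_tau (g : GL (Fin 2) R.F) (P : E[X]) (u : E) : (R.tau g P).eval u = R.dt g ^ R.m *
    ∑ i ∈ Finset.range (R.n + 1), P.coeff i *
      (((g 0 0 : E) + g 1 0 * u) ^ (R.n - i) * ((g 0 1 : E) + g 1 1 * u) ^ i) := by
  simp [tau_apply, eval_finsetSum]

lemma sum_homog (P : E[X]) {n : ℕ} (hP : P.degree ≤ n) {x : E} (hx : x ≠ 0) (y : E) :
    ∑ i ∈ Finset.range (n + 1), P.coeff i * (x ^ (n - i) * y ^ i) = x ^ n * P.eval (y / x) := by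
  rw [eval_eq_sum_range' (Nat.lt_succ_of_le (natDegree_le_iff_degree_le.2 hP)), Finset.mul_sum]
  refine Finset.sum_congr rfl fun i hi => ?_
  have hi := Finset.mem_range.1 hi
  obtain ⟨j, hj⟩ := Nat.exists_eq_add_of_le (Nat.lt_succ_iff.1 hi)
  rw [hj, Nat.add_sub_cancel_left, pow_add, div_pow]
  field_simp

lemma tau_one {P : E[X]} (hP : P.degree ≤ R.n) : R.tau 1 P = P := by
  rw [tau_apply]
  conv_rhs => rw [as_sum_range_C_mul_X_pow' P (Nat.lt_succ_of_le (natDegree_le_iff_degree_le.2 hP))]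
  simp [dt, smul_eq_C_mul]

variable [CharZero E]

lemma tau_mul_of_degree_le (g h : GL (Fin 2) R.F) {P : E[X]} (hP : P.degree ≤ R.n) :
    R.tau (g * h) P = R.tau g (R.tau h P) := by
  obtain ⟨p, hp⟩ : ∃ p : E[X], p = (C (g 0 0 : E) + C (g 1 0 : E) * X) *
    (C ((g * h) 0 0 : E) + C ((g * h) 1 0 : E) * X) := ⟨_, rfl⟩
  have hlin : ∀ g : GL (Fin 2) R.F, (C (g 0 0 : E) + C (g 1 0 : E) * X : E[X]) ≠ 0 := by
    intro g h0
    have c0 := congrArg (fun P : E[X] => P.coeff 0) h0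
    have c1 := congrArg (fun P : E[X] => P.coeff 1) h0
    simp [coeff_C] at c0 c1
    have := gl2_det_ne g
    simp [c0, c1] at this
  have hp0 : p ≠ 0 := hp ▸ mul_ne_zero (hlin g) (hlin (g * h))
  refine mul_right_cancel₀ hp0 (Polynomial.funext fun u => ?_)
  rw [eval_mul, eval_mul]
  by_cases hu : p.eval u = 0
  · rw [hu, mul_zero, mul_zero]
  congr 1
  rw [hp, eval_mul, ← ne_eq, mul_ne_zero_iff] at hu
  simp only [eval_add, eval_mul, eval_C, eval_X] at hu
  obtain ⟨hx, hx'⟩ := hu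
  rw [eval_tau, sum_homog _ hP hx', eval_tau, sum_homog _ (R.degree_tau_le h P) hx, eval_tau]
  set x : E := (g 0 0 : E) + g 1 0 * u with hxdef
  set y : E := (g 0 1 : E) + g 1 1 * u with hydef
  have e0 : ((g * h) 0 0 : E) + (g * h) 1 0 * u = (h 0 0 + h 1 0 * (y / x)) * x := by
    rw [add_mul, mul_assoc, div_mul_cancel₀ _ hx, hxdef, hydef, gl2_mul, gl2_mul]
    push_cast
    ring
  have e1 : ((g * h) 0 1 : E) + (g * h) 1 1 * u = (h 0 1 + h 1 1 * (y / x)) * x := by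
    rw [add_mul, mul_assoc, div_mul_cancel₀ _ hx, hxdef, hydef, gl2_mul, gl2_mul]
    push_cast
    ring
  rw [e0] at hx'
  rw [e0, e1, dt_mul, mul_zpow, sum_homog _ hP (left_ne_zero_of_mul hx'), mul_div_mul_right _ _ hx, mul_pow]
  ring

lemma tau_mul (g h : GL (Fin 2) R.F) (P : E[X]) :
    R.tau (g * h) P = R.tau g (R.tau h P) := by
  have key : ∀ g, R.tau g P =
      R.tau g (∑ i ∈ Finset.range (R.n + 1), C (P.coeff i) * X ^ i) := fun g => by
    rw [tau_apply, tau_apply]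
    congr 1
    refine Finset.sum_congr rfl fun i hi => ?_
    rw [finsetSum_coeff]
    simp only [coeff_C_mul_X_pow]
    rw [Finset.sum_ite_eq, if_pos hi]
  rw [key (g * h), key h, tau_mul_of_degree_le]
  rw [← natDegree_le_iff_degree_le]
  refine natDegree_sum_le_of_forall_le _ _ fun i hi => ?_
  exact (natDegree_C_mul_X_pow_le _ _).trans (Nat.lt_succ_iff.1 (Finset.mem_range.1 hi))

omit [CharZero E] in
lemma Bd_tau {κ : GL (Fin 2) R.F} (hκ : κ ∈ R.D.K) {ε : ℝ} {P : E[X]} (hP : Bd R.abs ε P) :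
    Bd R.abs ε (R.tau κ P) := by
  have hintegral : ∀ i j, R.abs (κ i j : E) ≤ 1 := fun i j => by
    rw [← R.hv]; exact hκ.1 i j
  have hdt : R.abs (R.dt κ ^ R.m) = 1 := by
    rw [map_zpow₀, dt_eq, ← R.hv, hκ.2, _root_.one_zpow]
  have hlin : ∀ a b : E, R.abs a ≤ 1 → R.abs b ≤ 1 → Bd R.abs 1 (C a + C b * X) :=
    fun a b ha hb => (Bd.C ha).add R.na (by simpa using (Bd.C hb).mul R.na Bd.X)
  rw [tau_apply, ← one_mul ε, ← hdt]
  refine Bd.smul _ (Bd.sum R.na hP.nonneg fun i _ => ?_)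
  refine (((((hlin _ _ (hintegral _ _) (hintegral _ _)).pow R.na _).mul R.na
    ((hlin _ _ (hintegral _ _) (hintegral _ _)).pow R.na _))).smul _).mono ?_
  simpa using hP i

/-- The uniformizer, as an element of `E`. -/
def p : E := ((R.D.ϖ : R.F) : E)

omit [CharZero E] in
lemma p_ne_zero : R.p ≠ 0 := by
  rw [p]; exact_mod_cast R.D.ϖ.ne_zero

omit [CharZero E] in
lemma abs_p : R.abs R.p = R.D.v R.D.ϖ := (R.hv _).symm

omit [CharZero E] in
lemma Bd_tau_del {ε : ℝ} {P : E[X]} (hP : Bd R.abs ε P) :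
    Bd R.abs (R.abs R.p ^ R.m * ε) (R.tau (R.D.del 1) P) := by
  have hdt : R.dt (R.D.del 1) = R.p := by simp [dt, Datum.del, p]
  have hp1 : R.abs R.p ≤ 1 := by rw [abs_p]; exact R.D.ϖ_lt.le
  rw [tau_apply, hdt, ← map_zpow₀]
  refine Bd.smul _ (Bd.sum R.na hP.nonneg fun i _ => ?_)
  have h00 : ((R.D.del 1 0 0 : R.F) : E) = R.p := by simp [Datum.del, p]
  have h01 : ((R.D.del 1 0 1 : R.F) : E) = 0 := by simp [Datum.del]
  have h10 : ((R.D.del 1 1 0 : R.F) : E) = 0 := by simp [Datum.del]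
  have h11 : ((R.D.del 1 1 1 : R.F) : E) = 1 := by simp [Datum.del]
  rw [h00, h01, h10, h11]
  simp only [map_zero, zero_mul, add_zero, zero_add, map_one, one_mul]
  refine Bd.mono (Bd.smul (ε := 1) _ ?_) (by simpa using hP i)
  simpa using ((Bd.C hp1).pow R.na (R.n - i)).mul R.na ((Bd.X).pow R.na i)

omit [CharZero E] in
lemma tau_scal (j : ℤ) {P : E[X]} (hP : P.degree ≤ R.n) :
    R.tau (R.D.scal j) P = (R.p ^ (2 * R.m + R.n)) ^ j • P := by
  have h00 : ((R.D.scal j 0 0 : R.F) : E) = R.p ^ j := map_zpow₀ R.F.subtype _ j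
  have h01 : ((R.D.scal j 0 1 : R.F) : E) = 0 := by simp [Datum.scal]
  have h10 : ((R.D.scal j 1 0 : R.F) : E) = 0 := by simp [Datum.scal]
  have h11 : ((R.D.scal j 1 1 : R.F) : E) = R.p ^ j := map_zpow₀ R.F.subtype _ j
  have hdt : R.dt (R.D.scal j) = R.p ^ j * R.p ^ j := by
    rw [dt, h00, h01, h11, zero_mul, sub_zero]
  have e : (R.p ^ (2 * R.m + R.n)) ^ j = (R.p ^ j * R.p ^ j) ^ R.m * (R.p ^ j) ^ R.n := by
    rw [← zpow_natCast (R.p ^ j), ← zpow_add₀ R.p_ne_zero, ← _root_.zpow_mul, ← _root_.zpow_mul,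
      ← _root_.zpow_mul, ← zpow_add₀ R.p_ne_zero]
    congr 1
    ring
  rw [tau_apply, hdt, h00, h01, h10, h11, e, mul_smul]
  congr 1
  conv_rhs => rw [as_sum_range_C_mul_X_pow' P (Nat.lt_succ_of_le (natDegree_le_iff_degree_le.2 hP))]
  rw [Finset.smul_sum]
  refine Finset.sum_congr rfl fun i hi => ?_
  obtain ⟨l, hl⟩ := Nat.exists_eq_add_of_le (Nat.lt_succ_iff.1 (Finset.mem_range.1 hi))
  rw [hl, Nat.add_sub_cancel_left]
  simp only [map_zero, zero_mul, add_zero, zero_add, smul_eq_C_mul, mul_pow, ← C_pow]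
  rw [pow_add, C_mul]
  ring

omit [CharZero E] in
lemma eval_tau_chd (b : R.F) (P : E[X]) :
    (R.tau (R.D.chd b) P).eval (-(b : E)) = R.p ^ (R.m + R.n) * P.coeff 0 := by
  rw [eval_tau, Finset.sum_eq_single 0]
  · rw [zpow_add₀ R.p_ne_zero, zpow_natCast]
    simp [dt, Datum.chd, p]
    ring
  · intro i _ hi
    simp [Datum.chd, hi]
  · simp

end RepDatum

end Rep

section Descent

open Polynomial

namespace Datum

variable {k : Type} [Field k] {E : Type} [Field E] (D : Datum k E)

lemma upp_mul_upp (a b : k) : (upp a * upp b : GL (Fin 2) k) = upp (a + b) := by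
  apply gl2_ext <;> simp [gl2_mul, upp, add_comm]

lemma upp_mul_del_succ (r : ℕ) (b : k) :
    upp ((D.ϖ : k) ^ r * b) * D.del (r + 1 : ℕ) = D.del r * D.chd b := by
  apply gl2_ext <;> simp [gl2_mul, upp, del, chd, zpow_add₀ D.ϖ.ne_zero]

/-- The elements of `GL₂(𝒪)` whose upper right entry is divisible by `ϖ^r`. -/
def lowerK (r : ℕ) : Subgroup (GL (Fin 2) k) where
  carrier := {g | g ∈ D.K ∧ D.v (g 0 1) ≤ D.v D.ϖ ^ r}
  mul_mem' := by
    rintro g h ⟨hg, hg'⟩ ⟨hh, hh'⟩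
    refine ⟨D.K.mul_mem hg hh, ?_⟩
    rw [gl2_mul]
    refine (D.na _ _).trans (max_le ?_ ?_) <;> rw [map_mul]
    · exact (mul_le_of_le_one_left (D.v.nonneg _) (hg.1 _ _)).trans hh'
    · exact (mul_le_of_le_one_right (D.v.nonneg _) (hh.1 _ _)).trans hg'
  one_mem' := ⟨D.K.one_mem, by simp⟩
  inv_mem' := by
    rintro g ⟨hg, hg'⟩
    refine ⟨D.K.inv_mem hg, ?_⟩
    rw [gl2_inv]
    simpa [hg.2] using hg'

lemma exists_child {κ₀ κ : GL (Fin 2) k} {r : ℕ} (hr : 1 ≤ r) (h : κ₀⁻¹ * κ ∈ D.lowerK r) :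
    ∃ b, ∃ κ' ∈ D.K, κ * D.del (r + 1 : ℕ) = κ₀ * D.del r * D.chd (D.t b) * κ' := by
  obtain ⟨hm, h01⟩ := h
  obtain ⟨M, hM⟩ : ∃ M, M = κ₀⁻¹ * κ := ⟨_, rfl⟩
  rw [← hM] at hm h01
  have hϖ : (D.ϖ : k) ^ r ≠ 0 := pow_ne_zero _ D.ϖ.ne_zero
  have h01' : D.v (M 0 1) < 1 := h01.trans_lt (pow_lt_one₀ D.ϖ_pos.le D.ϖ_lt (by omega))
  have h11 : D.v (M 1 1) = 1 := by
    refine le_antisymm (hm.1 _ _) ?_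
    have hdet := hm.2
    have : D.v (M 0 0 * M 1 1 - M 0 1 * M 1 0) ≤ _ := D.na_sub _ _
    rw [hdet, map_mul, map_mul] at this
    rcases le_max_iff.1 this with h | h
    · exact h.trans (mul_le_of_le_one_left (D.v.nonneg _) (hm.1 _ _))
    · exact absurd (h.trans (mul_le_of_le_one_right (D.v.nonneg _) (hm.1 _ _))) (not_le.2 h01')
  have h11' : M 1 1 ≠ 0 := fun h0 => by simp [h0] at h11
  obtain ⟨b, hb⟩ := D.t_cov (M 0 1 / (D.ϖ ^ r * M 1 1)) (by
    rw [map_div₀, map_mul, h11, mul_one, map_pow]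
    exact div_le_one_of_le₀ h01 (pow_nonneg D.ϖ_pos.le _))
  have hu : upp (-((D.ϖ : k) ^ r * D.t b)) ∈ D.K := D.upp_mem (by
    rw [D.v.map_neg, map_mul, map_pow]
    exact mul_le_one₀ (pow_le_one₀ D.ϖ_pos.le D.ϖ_lt.le) (D.v.nonneg _) (D.t_int b))
  have hc := D.conj_del_mem (D.K.mul_mem hu hm) (r + 1) (by
    have e : (upp (-((D.ϖ : k) ^ r * D.t b)) * M) 0 1 =
        D.ϖ ^ r * M 1 1 * (M 0 1 / (D.ϖ ^ r * M 1 1) - D.t b) := by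
      rw [gl2_mul]
      simp only [upp, mk2_00, mk2_01]
      field_simp
      ring
    rw [e, map_mul, map_mul, h11, mul_one, map_pow, pow_succ]
    exact mul_le_mul_of_nonneg_left hb (pow_nonneg D.ϖ_pos.le _))
  refine ⟨b, _, hc, ?_⟩
  rw [mul_assoc κ₀, ← upp_mul_del_succ]
  have e : (upp ((D.ϖ : k) ^ r * D.t b) * upp (-((D.ϖ : k) ^ r * D.t b)) : GL (Fin 2) k) = 1 := by
    rw [upp_mul_upp, add_neg_cancel]
    apply gl2_ext <;> simp [upp]
  calc κ * D.del (r + 1 : ℕ) = κ₀ * 1 * M * D.del (r + 1 : ℕ) := by rw [hM]; group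
    _ = _ := by rw [← e]; group

/-- A point separating the children of the vertex `ϖ^r`. -/
def tst (r : ℕ) (b : Fin D.q) : GL (Fin 2) k := wey * upp (-((D.ϖ : k) ^ r * D.t b))

lemma Near.conj {D : Datum k E} {r : ℕ} {h κ : GL (Fin 2) k} (hκ : κ ∈ D.K) (H : D.Near r h) :
    D.Near r (κ * h * κ⁻¹) := fun i j => by
  have e := congrFun (congrFun (conj_entry κ⁻¹ h) i) j
  rw [inv_inv, Matrix.sub_apply] at e
  erw [e]
  have := D.mul_entry_le (D.mul_entry_le hκ.1 H) (D.K.inv_mem hκ).1 i j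
  rwa [one_mul, mul_one] at this

lemma exists_near_tst {κ₀ : GL (Fin 2) k} (hκ : κ₀ ∈ D.K) (r : ℕ) (b b' : Fin D.q) :
    ∃ h, D.Near r h ∧ D.tst r b * κ₀⁻¹ = D.tst r b' * κ₀⁻¹ * h := by
  refine ⟨κ₀ * upp ((D.ϖ : k) ^ r * (D.t b' - D.t b)) * κ₀⁻¹, Near.conj hκ fun i j => ?_, ?_⟩
  · have hp := pow_nonneg D.ϖ_pos.le r
    fin_cases i <;> fin_cases j <;> simp [upp, hp]
    exact (D.na_sub _ _).trans (max_le (D.t_int _) (D.t_int _))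
  · have : upp (-((D.ϖ : k) ^ r * D.t b)) = upp (-((D.ϖ : k) ^ r * D.t b')) *
        upp ((D.ϖ : k) ^ r * (D.t b' - D.t b)) := by
      rw [upp_mul_upp]
      congr 1
      ring
    rw [tst, this, tst]
    group

lemma phi_tst_of_lt {M : GL (Fin 2) k} (hM : M ∈ D.K) {r : ℕ} (h : D.v D.ϖ ^ r < D.v (M 0 1))
    (b b' : Fin D.q) :
    D.phi (D.tst r b * (M * D.del (r + 1 : ℕ))) = D.phi (D.tst r b' * (M * D.del (r + 1 : ℕ))) := by
  have hdet : ∀ b, Matrix.GeneralLinearGroup.det (D.tst r b) =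
      Matrix.GeneralLinearGroup.det (wey : GL (Fin 2) k) := fun b => by
    apply Units.ext
    rw [gl2_det, gl2_det]
    simp [tst, wey, upp, gl2_mul]
  have hintegral : ∀ b, D.v ((D.ϖ : k) ^ r * D.t b) ≤ D.v D.ϖ ^ r := fun b => by
    rw [map_mul, map_pow]
    exact mul_le_of_le_one_right (pow_nonneg D.ϖ_pos.le _) (D.t_int _)
  have hrow : ∀ b, D.rowNorm (D.tst r b * (M * D.del (r + 1 : ℕ))) = D.v (M 0 1) := fun b => by
    have e0 : (D.tst r b * (M * D.del (r + 1 : ℕ))) 1 0 =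
        (upp (-((D.ϖ : k) ^ r * D.t b)) * M) 0 0 * D.ϖ ^ (r + 1) := by
      simp [tst, gl2_mul, wey, upp, del, zpow_add₀ D.ϖ.ne_zero]
      ring
    have e1 : (D.tst r b * (M * D.del (r + 1 : ℕ))) 1 1 =
        -((D.ϖ : k) ^ r * D.t b) * M 1 1 + M 0 1 := by
      simp [tst, gl2_mul, wey, upp, del]
      ring
    have h1 : D.v (-((D.ϖ : k) ^ r * D.t b) * M 1 1 + M 0 1) = D.v (M 0 1) := by
      refine D.add_eq_of_lt (lt_of_le_of_lt ?_ h)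
      rw [map_mul, D.v.map_neg]
      exact (mul_le_of_le_one_right (D.v.nonneg _) (hM.1 _ _)).trans (hintegral b)
    rw [rowNorm, e0, e1, h1]
    apply max_eq_right
    rw [map_mul, map_pow, pow_succ]
    refine le_trans ?_ h.le
    refine (mul_le_of_le_one_left (mul_nonneg (pow_nonneg D.ϖ_pos.le _) D.ϖ_pos.le) ?_).trans
      (mul_le_of_le_one_right (pow_nonneg D.ϖ_pos.le _) D.ϖ_lt.le)
    refine (D.K.mul_mem (D.upp_mem ?_) hM).1 _ _
    rw [D.v.map_neg]
    exact (hintegral b).trans (pow_le_one₀ D.ϖ_pos.le D.ϖ_lt.le)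
  rw [phi, phi, hrow, hrow, map_mul, map_mul _ (D.tst r b'), hdet, hdet]

lemma exists_phi_tst (r : ℕ) : ∃ c : E, c ≠ 0 ∧ ∀ b b',
    D.phi (D.tst r b * (D.del r * D.chd (D.t b'))) = if b' = b then D.θ * c else c := by
  obtain ⟨w, hw⟩ : ∃ w : kˣ, w = D.ϖ ^ r := ⟨_, rfl⟩
  have hw' : (w : k) = (D.ϖ : k) ^ r := by rw [hw, Units.val_pow_eq_pow_val]
  refine ⟨D.χ₁ (Matrix.GeneralLinearGroup.det (wey * (D.del r * D.chd 0))) * D.χ w,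
    mul_ne_zero (Units.ne_zero _) (Units.ne_zero _), fun b b' => ?_⟩
  have hdet : Matrix.GeneralLinearGroup.det (D.tst r b * (D.del r * D.chd (D.t b'))) =
      Matrix.GeneralLinearGroup.det (wey * (D.del r * D.chd 0)) := by
    apply Units.ext
    rw [gl2_det, gl2_det]
    simp [tst, wey, upp, gl2_mul, del, chd]
  have hrow : D.rowNorm (D.tst r b * (D.del r * D.chd (D.t b'))) =
      max (D.v ((D.ϖ : k) ^ r * D.ϖ)) (D.v ((D.ϖ : k) ^ r * (D.t b' - D.t b))) := by
    rw [rowNorm]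
    congr 2
    · simp [tst, wey, upp, gl2_mul, del, chd]
    · simp [tst, wey, upp, gl2_mul, del, chd]
      ring
  rw [phi, hdet, hrow]
  split_ifs with h
  · rw [h, sub_self, mul_zero, map_zero, max_eq_left (D.v.nonneg _), ← hw', mul_comm (w : k),
      map_mul D.v, th_mul, th_v, θ]
    ring
  · rw [map_mul D.v, map_mul D.v, D.t_sep _ _ h, max_eq_right (mul_le_mul_of_nonneg_left D.ϖ_lt.le
      (D.v.nonneg _)), mul_one, ← hw', th_v]

end Datum

namespace RepDatum

variable {E : Type} [Field E] (R : RepDatum E)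

/-- The lattice in the algebraic representation attached to `g`. -/
def InLat (g : GL (Fin 2) R.F) (ε : ℝ) (P : E[X]) : Prop :=
  ∃ Q : E[X], Q.degree ≤ R.n ∧ Bd R.abs ε Q ∧ P = R.tau g Q

variable {R}

lemma InLat.zero (g : GL (Fin 2) R.F) {ε : ℝ} (hε : 0 ≤ ε) : R.InLat g ε 0 :=
  ⟨0, by simp, Bd.zero hε, by simp⟩

lemma InLat.add {g : GL (Fin 2) R.F} {ε : ℝ} {P Q : E[X]} (hP : R.InLat g ε P)
    (hQ : R.InLat g ε Q) : R.InLat g ε (P + Q) := by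
  obtain ⟨P', dP, bP, rfl⟩ := hP
  obtain ⟨Q', dQ, bQ, rfl⟩ := hQ
  exact ⟨P' + Q', (degree_add_le _ _).trans (max_le dP dQ), bP.add R.na bQ, by rw [map_add]⟩

lemma InLat.sum {ι : Type} {s : Finset ι} {g : GL (Fin 2) R.F} {ε : ℝ} (hε : 0 ≤ ε)
    {P : ι → E[X]} (h : ∀ i ∈ s, R.InLat g ε (P i)) : R.InLat g ε (∑ i ∈ s, P i) :=
  Finset.sum_induction P (R.InLat g ε) (fun _ _ => InLat.add) (InLat.zero g hε) h

lemma InLat.smul {g : GL (Fin 2) R.F} {ε : ℝ} {P : E[X]} (hP : R.InLat g ε P) {c : E} {δ : ℝ}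
    (hc : R.abs c * ε ≤ δ) : R.InLat g δ (c • P) := by
  obtain ⟨P', dP, bP, rfl⟩ := hP
  exact ⟨c • P', (degree_smul_le _ _).trans dP, (bP.smul c).mono hc, by rw [map_smul]⟩

lemma InLat.degree_le {g : GL (Fin 2) R.F} {ε : ℝ} {P : E[X]} (hP : R.InLat g ε P) :
    P.degree ≤ R.n := by
  obtain ⟨P', dP, bP, rfl⟩ := hP
  exact R.degree_tau_le _ _

variable [CharZero E]

lemma InLat.mul_K {g κ : GL (Fin 2) R.F} {ε : ℝ} {P : E[X]} (hP : R.InLat (g * κ) ε P)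
    (hκ : κ ∈ R.D.K) : R.InLat g ε P := by
  obtain ⟨P', dP, bP, rfl⟩ := hP
  exact ⟨_, R.degree_tau_le κ P', R.Bd_tau hκ bP, R.tau_mul _ _ _⟩

lemma InLat.tau {g : GL (Fin 2) R.F} {ε : ℝ} {P : E[X]} (hP : R.InLat g ε P)
    (h : GL (Fin 2) R.F) : R.InLat (h * g) ε (R.tau h P) := by
  obtain ⟨P', dP, bP, rfl⟩ := hP
  exact ⟨P', dP, bP, (R.tau_mul _ _ _).symm⟩

lemma InLat.of_children {g : GL (Fin 2) R.F} {ε : ℝ} {P : E[X]}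
    (h : ∀ b, R.InLat (g * R.D.chd (R.D.t b)) ε P) :
    R.InLat g (R.abs (R.p ^ (R.m + R.n)) * ε) P := by
  have hP : P.degree ≤ R.n := (h ⟨0, by have := R.hn; omega⟩).degree_le
  refine ⟨R.tau g⁻¹ P, R.degree_tau_le _ _, ?_, ?_⟩
  · refine Bd.of_eval R.na (x := fun b => -(R.D.t b : E)) (fun b => ?_) (fun b b' hb => ?_) R.hn
      (R.degree_tau_le _ _) fun b => ?_
    · rw [R.abs.map_neg, ← R.hv]
      exact R.D.t_int b
    · have := R.D.t_sep b' b hb.symm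
      rw [R.hv] at this
      rw [← this]
      congr 1
      push_cast
      ring
    · obtain ⟨Q, dQ, bQ, e⟩ := h b
      rw [e, ← tau_mul, inv_mul_cancel_left, eval_tau_chd, map_mul]
      exact mul_le_mul_of_nonneg_left (bQ 0) (R.abs.nonneg _)
  · rw [← tau_mul, mul_inv_cancel, R.tau_one hP]

variable (R)

/-- The function `x ↦ φ(xg) P`. -/
def fn (g : GL (Fin 2) R.F) (P : E[X]) : GL (Fin 2) R.F → E[X] := fun x => R.D.phi (x * g) • P

/-- Sums of functions attached to vertices at distance at most `r` from the origin. -/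
def M (r : ℕ) (ε : ℝ) : AddSubmonoid (GL (Fin 2) R.F → E[X]) :=
  AddSubmonoid.closure {f | ∃ κ ∈ R.D.K, ∃ s ≤ r, ∃ P, R.InLat (κ * R.D.del (s : ℕ)) ε P ∧
    f = R.fn (κ * R.D.del (s : ℕ)) P}

variable {R}

omit [CharZero E] in
lemma fn_mem_M {κ : GL (Fin 2) R.F} (hκ : κ ∈ R.D.K) {s r : ℕ} (hs : s ≤ r) {ε : ℝ} {P : E[X]}
    (hP : R.InLat (κ * R.D.del (s : ℕ)) ε P) : R.fn (κ * R.D.del (s : ℕ)) P ∈ R.M r ε :=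
  AddSubmonoid.subset_closure ⟨κ, hκ, s, hs, P, hP, rfl⟩

omit [CharZero E] in
lemma M_mono {r s : ℕ} (h : r ≤ s) (ε : ℝ) : R.M r ε ≤ R.M s ε :=
  AddSubmonoid.closure_mono fun _ ⟨κ, hκ, t, ht, P⟩ => ⟨κ, hκ, t, ht.trans h, P⟩

omit [CharZero E] in
lemma M_near {r : ℕ} (hr : 1 ≤ r) {ε : ℝ} {f : GL (Fin 2) R.F → E[X]} (hf : f ∈ R.M r ε)
    (x : GL (Fin 2) R.F) {h : GL (Fin 2) R.F} (hh : R.D.Near r h) : f (x * h) = f x := by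
  induction hf using AddSubmonoid.closure_induction with
  | mem f hf =>
    obtain ⟨κ, hκ, s, hs, P, _, rfl⟩ := hf
    have := R.D.phi_mul_K (x * (κ * R.D.del s)) (R.D.conj_near_mem hκ hr hs hh)
    simp only [fn]
    rw [← this]
    congr 2
    group
  | zero => rfl
  | add f g _ _ hf hg => simp only [Pi.add_apply, hf, hg]

omit [CharZero E] in
lemma M_decomp {r : ℕ} {ε : ℝ} {f : GL (Fin 2) R.F → E[X]} (hf : f ∈ R.M (r + 1) ε) :
    ∃ m₀ ∈ R.M r ε, ∃ (ι : Type) (_ : Fintype ι) (κ : ι → GL (Fin 2) R.F) (P : ι → E[X]),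
      (∀ i, κ i ∈ R.D.K) ∧ (∀ i, R.InLat (κ i * R.D.del (r + 1 : ℕ)) ε (P i)) ∧
      f = m₀ + ∑ i, R.fn (κ i * R.D.del (r + 1 : ℕ)) (P i) := by
  induction hf using AddSubmonoid.closure_induction with
  | mem f hf =>
    obtain ⟨κ, hκ, s, hs, P, hP, rfl⟩ := hf
    rcases Nat.le_or_eq_of_le_succ hs with hs | rfl
    · exact ⟨_, fn_mem_M hκ hs hP, Empty, inferInstance, Empty.elim, Empty.elim, fun i => i.elim,
        fun i => i.elim, by simp⟩
    · exact ⟨0, zero_mem _, Unit, inferInstance, fun _ => κ, fun _ => P, fun _ => hκ,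
        fun _ => hP, by simp⟩
  | zero =>
    exact ⟨0, zero_mem _, Empty, inferInstance, Empty.elim, Empty.elim, fun i => i.elim,
        fun i => i.elim, by simp⟩
  | add f g _ _ hf hg =>
    obtain ⟨m₁, h₁, ι₁, _, κ₁, P₁, hκ₁, hP₁, rfl⟩ := hf
    obtain ⟨m₂, h₂, ι₂, _, κ₂, P₂, hκ₂, hP₂, rfl⟩ := hg
    refine ⟨m₁ + m₂, add_mem h₁ h₂, ι₁ ⊕ ι₂, inferInstance, Sum.elim κ₁ κ₂, Sum.elim P₁ P₂,
      Sum.rec hκ₁ hκ₂, Sum.rec hP₁ hP₂, ?_⟩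
    rw [Fintype.sum_sum_type]
    simp only [Sum.elim_inl, Sum.elim_inr]
    abel

lemma siblings_mem_M {κ : GL (Fin 2) R.F} (hκ : κ ∈ R.D.K) {r : ℕ} (hr : 1 ≤ r) {ε : ℝ}
    {Q : Fin R.D.q → E[X]} (hQ : ∀ b, R.InLat (κ * R.D.del r * R.D.chd (R.D.t b)) ε (Q b))
    (h : ∀ b b', ∑ c, R.D.phi (R.D.tst r b * (R.D.del r * R.D.chd (R.D.t c))) • Q c =
      ∑ c, R.D.phi (R.D.tst r b' * (R.D.del r * R.D.chd (R.D.t c))) • Q c) :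
    ∑ b, R.fn (κ * R.D.del r * R.D.chd (R.D.t b)) (Q b) ∈ R.M r ε := by
  obtain ⟨c, hc, hphi⟩ := R.D.exists_phi_tst r
  have hsum : ∀ b, ∑ b', R.D.phi (R.D.tst r b * (R.D.del r * R.D.chd (R.D.t b'))) • Q b' =
      c • ∑ b', Q b' + ((R.D.θ - 1) * c) • Q b := fun b => by
    have : ∀ b', R.D.phi (R.D.tst r b * (R.D.del r * R.D.chd (R.D.t b'))) • Q b' =
        c • Q b' + if b' = b then ((R.D.θ - 1) * c) • Q b' else 0 := fun b' => by
      rw [hphi]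
      split_ifs
      · rw [← add_smul]
        congr 1
        ring
      · rw [add_zero]
    simp only [this]
    rw [Finset.sum_add_distrib, Finset.smul_sum, Finset.sum_ite_eq' _ b,
      if_pos (Finset.mem_univ _)]
  have hconst : ∀ b b', Q b = Q b' := fun b b' => by
    have := h b b'
    rw [hsum, hsum, add_right_inj] at this
    exact smul_right_injective _ (mul_ne_zero (sub_ne_zero.2 R.D.θ_ne_one) hc) this
  obtain ⟨P, hP⟩ : ∃ P, ∀ b, Q b = P := ⟨Q ⟨0, by have := R.hn; omega⟩, fun b => hconst _ _⟩
  simp only [hP] at hQ ⊢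
  obtain ⟨s, rfl⟩ := Nat.exists_eq_add_of_le' hr
  have hL := InLat.of_children hQ
  have hε : 0 ≤ ε := by
    obtain ⟨_, _, b, _⟩ := hQ ⟨0, by have := R.hn; omega⟩
    exact b.nonneg
  have e : ∑ b, R.fn (κ * R.D.del (s + 1 : ℕ) * R.D.chd (R.D.t b)) P =
      R.fn (κ * R.D.del (s + 1 : ℕ)) (((R.D.θ + R.D.q) * R.D.χ₁ R.D.ϖ) • P) +
      R.fn (κ * R.D.del (s : ℕ)) ((-(R.D.θ * (R.D.χ₁ R.D.ϖ) ^ 2)) • P) := by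
    ext1 x
    have hd : κ * R.D.del (s : ℕ) = κ * R.D.del (s + 1 : ℕ) * R.D.del (-1) := by
      rw [mul_assoc, ← R.D.del_add]
      congr 2
      push_cast
      ring
    rw [hd]
    simp only [Finset.sum_apply, Pi.add_apply, fn, smul_smul, ← Finset.sum_smul, ← add_smul,
      ← mul_assoc]
    congr 1
    have hs := R.D.sum_phi (x * (κ * R.D.del (s + 1 : ℕ)))
    simp only [mul_assoc] at hs ⊢
    rw [hs]
    ring
  rw [e]
  refine add_mem (fn_mem_M hκ le_rfl (hL.smul ?_)) (fn_mem_M hκ (Nat.le_succ s) ?_)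
  · rw [← mul_assoc, ← map_mul, add_mul, R.D.θ_eq]
    exact mul_le_of_le_one_left hε R.bs_le
  · obtain ⟨S, dS, bS, rfl⟩ := hL
    have hd : κ * R.D.del (s + 1 : ℕ) = κ * R.D.del (s : ℕ) * R.D.del 1 := by
      rw [mul_assoc, ← R.D.del_add]
      congr 2
    rw [hd, tau_mul]
    refine InLat.smul ⟨_, R.degree_tau_le _ _, R.Bd_tau_del bS, rfl⟩ (le_of_eq ?_)
    rw [R.abs.map_neg, ← map_zpow₀, ← mul_assoc, ← mul_assoc, ← map_mul, ← map_mul]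
    refine (congrArg (· * ε) ?_).trans (one_mul ε)
    rw [← R.bs_eq]
    congr 1
    rw [pow_two, ← mul_assoc, R.D.θ_eq, mul_assoc, ← zpow_add₀ R.p_ne_zero, p]
    rw [two_mul, add_assoc, mul_comm (R.D.χ₂ R.D.ϖ : E)]

lemma M_descent {r : ℕ} (hr : 1 ≤ r) {ε : ℝ} (hε : 0 ≤ ε) {f : GL (Fin 2) R.F → E[X]}
    (hf : f ∈ R.M (r + 1) ε) (hinv : ∀ x h, R.D.Near r h → f (x * h) = f x) : f ∈ R.M r ε := by
  obtain ⟨m₀, hm₀, ι, _, κ, P, hκ, hP, rfl⟩ := M_decomp hf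
  refine add_mem hm₀ ?_
  obtain ⟨cl, hcl⟩ : ∃ cl : ι → GL (Fin 2) R.F ⧸ R.D.lowerK r, ∀ i, cl i = QuotientGroup.mk (κ i) :=
    ⟨_, fun _ => rfl⟩
  rw [← Finset.sum_fiberwise_of_maps_to (s := Finset.univ) (t := Finset.univ.image cl) (g := cl)
    (fun i _ => Finset.mem_image_of_mem _ (Finset.mem_univ _))]
  refine sum_mem fun c hc => ?_
  obtain ⟨i₀, _, rfl⟩ := Finset.mem_image.1 hc
  have hchild : ∀ i, ∃ b, cl i = cl i₀ → ∃ κ' ∈ R.D.K,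
      κ i * R.D.del (r + 1 : ℕ) = κ i₀ * R.D.del r * R.D.chd (R.D.t b) * κ' := fun i => by
    by_cases h : cl i = cl i₀
    · rw [hcl, hcl, eq_comm, QuotientGroup.eq] at h
      obtain ⟨b, hb⟩ := R.D.exists_child hr h
      exact ⟨b, fun _ => hb⟩
    · exact ⟨⟨0, by have := R.hn; omega⟩, fun h' => absurd h' h⟩
  choose b hb using hchild
  obtain ⟨Q, hQ⟩ : ∃ Q : Fin R.D.q → E[X], ∀ c, Q c = ∑ i with cl i = cl i₀ ∧ b i = c, P i :=
    ⟨_, fun _ => rfl⟩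
  have hfib : ∑ i with cl i = cl i₀, R.fn (κ i * R.D.del (r + 1 : ℕ)) (P i) =
      ∑ c, R.fn (κ i₀ * R.D.del r * R.D.chd (R.D.t c)) (Q c) := by
    rw [← Finset.sum_fiberwise _ b]
    refine Finset.sum_congr rfl fun c _ => ?_
    ext1 x
    rw [Finset.filter_filter, hQ, Finset.sum_apply, fn, Finset.smul_sum]
    refine Finset.sum_congr rfl fun i hi => ?_
    obtain ⟨_, h1, h2⟩ := Finset.mem_filter.1 hi
    obtain ⟨κ', hκ', e⟩ := hb i h1
    rw [fn, e, ← mul_assoc, R.D.phi_mul_K _ hκ', h2]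
  rw [hfib]
  refine siblings_mem_M (hκ i₀) hr (fun c => ?_) fun c c' => ?_
  · rw [hQ]
    refine InLat.sum hε fun i hi => ?_
    obtain ⟨_, h1, h2⟩ := Finset.mem_filter.1 hi
    obtain ⟨κ', hκ', e⟩ := hb i h1
    have := hP i
    rw [e, h2] at this
    exact this.mul_K hκ'
  · have hval : ∀ c, ∑ d, R.D.phi (R.D.tst r c * (R.D.del r * R.D.chd (R.D.t d))) • Q d =
        (∑ i with cl i = cl i₀, R.fn (κ i * R.D.del (r + 1 : ℕ)) (P i))
          (R.D.tst r c * (κ i₀)⁻¹) := fun c => by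
      rw [hfib, Finset.sum_apply]
      refine Finset.sum_congr rfl fun d _ => ?_
      rw [fn]
      congr 2
      group
    obtain ⟨h, hh, e⟩ := R.D.exists_near_tst (hκ i₀) r c c'
    have hf := hinv (R.D.tst r c' * (κ i₀)⁻¹) h hh
    have hm := M_near hr hm₀ (R.D.tst r c' * (κ i₀)⁻¹) hh
    rw [← e] at hf hm
    rw [hval, hval]
    rw [Pi.add_apply, Pi.add_apply, hm, add_right_inj,
      ← Finset.sum_filter_add_sum_filter_not Finset.univ (fun i => cl i = cl i₀), Pi.add_apply,
      Pi.add_apply] at hf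
    have hrest : ∀ c c', (∑ i with ¬ cl i = cl i₀, R.fn (κ i * R.D.del (r + 1 : ℕ)) (P i))
        (R.D.tst r c * (κ i₀)⁻¹) = (∑ i with ¬ cl i = cl i₀,
          R.fn (κ i * R.D.del (r + 1 : ℕ)) (P i)) (R.D.tst r c' * (κ i₀)⁻¹) := fun c c' => by
      rw [Finset.sum_apply, Finset.sum_apply]
      refine Finset.sum_congr rfl fun i hi => ?_
      have hi := (Finset.mem_filter.1 hi).2
      rw [hcl, hcl, eq_comm, QuotientGroup.eq] at hi
      have hM := R.D.K.mul_mem (R.D.K.inv_mem (hκ i₀)) (hκ i)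
      have hlt : R.D.v R.D.ϖ ^ r < R.D.v (((κ i₀)⁻¹ * κ i) 0 1) := by
        by_contra! h'
        exact hi ⟨hM, h'⟩
      have := R.D.phi_tst_of_lt hM hlt c c'
      rw [fn, fn]
      simp only [← mul_assoc] at this ⊢
      rw [this]
    rw [hrest c c', add_left_inj] at hf
    exact hf

lemma M_descent_le {r s : ℕ} (hr : 1 ≤ r) (hrs : r ≤ s) {ε : ℝ} (hε : 0 ≤ ε)
    {f : GL (Fin 2) R.F → E[X]} (hf : f ∈ R.M s ε)
    (hinv : ∀ x h, R.D.Near r h → f (x * h) = f x) : f ∈ R.M r ε := by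
  induction s, hrs using Nat.le_induction with
  | base => exact hf
  | succ s hrs ih => exact ih (M_descent (hr.trans hrs) hε hf fun x h hh => hinv x h (hh.mono hrs))

end RepDatum

end Descent

section Generation

namespace Datum

variable {k : Type} [Field k] {E : Type} [Field E] (D : Datum k E)

/-- The left equivariance of the functions in the induced representation. -/
def LeftEq (f : GL (Fin 2) k → E) : Prop :=
  ∀ (b x : GL (Fin 2) k), b 1 0 = 0 → ∀ u₁ u₂ : kˣ, b 0 0 = u₁ → b 1 1 = u₂ →
    f (b * x) = D.χ₁ u₁ * D.χ₂ u₂ * f x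

/-- Right invariance under the principal congruence subgroup of level `r`. -/
def RightInv {V : Type} (r : ℕ) (f : GL (Fin 2) k → V) : Prop := ∀ x h, D.Near r h → f (x * h) = f x

lemma exists_diag {b : GL (Fin 2) k} (hb : b 1 0 = 0) :
    ∃ u₁ u₂ : kˣ, b 0 0 = u₁ ∧ b 1 1 = u₂ := by
  have h := gl2_det_ne b
  rw [hb, mul_zero, sub_zero] at h
  exact ⟨Units.mk0 _ (left_ne_zero_of_mul h), Units.mk0 _ (right_ne_zero_of_mul h), rfl, rfl⟩

lemma exists_net (r : ℕ) : ∃ T : Finset k, (∀ a ∈ T, D.v a ≤ 1) ∧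
    ∀ a, D.v a ≤ 1 → ∃ a' ∈ T, D.v (a - a') ≤ D.v D.ϖ ^ r := by
  induction r with
  | zero => exact ⟨{0}, by simp, fun a ha => ⟨0, by simp, by simpa using ha⟩⟩
  | succ r ih =>
    obtain ⟨T, hT, hcov⟩ := ih
    refine ⟨(Finset.univ ×ˢ T).image fun p => D.t p.1 + D.ϖ * p.2, fun a ha => ?_, fun a ha => ?_⟩
    · obtain ⟨p, hp, rfl⟩ := Finset.mem_image.1 ha
      refine (D.na _ _).trans (max_le (D.t_int _) ?_)
      rw [map_mul]
      exact mul_le_one₀ D.ϖ_lt.le (D.v.nonneg _) (hT _ (Finset.mem_product.1 hp).2)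
    · obtain ⟨b, hb⟩ := D.t_cov a ha
      have hϖ : (D.ϖ : k) ≠ 0 := D.ϖ.ne_zero
      obtain ⟨a', ha', h⟩ := hcov ((a - D.t b) / D.ϖ) (by
        rw [map_div₀]; exact div_le_one_of_le₀ hb D.ϖ_pos.le)
      refine ⟨_, Finset.mem_image.2 ⟨(b, a'), Finset.mem_product.2 ⟨Finset.mem_univ _, ha'⟩, rfl⟩, ?_⟩
      have e : a - (D.t b + D.ϖ * a') = D.ϖ * ((a - D.t b) / D.ϖ - a') := by
        field_simp
        ring
      rw [e, map_mul, pow_succ']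
      exact mul_le_mul_of_nonneg_left h D.ϖ_pos.le

lemma low_near {a : k} {r : ℕ} (h : D.v a ≤ D.v D.ϖ ^ r) : D.Near r (low a) := fun i j => by
  have := pow_nonneg D.ϖ_pos.le r
  fin_cases i <;> fin_cases j <;> simp [low, h, this]

lemma upp_near {a : k} {r : ℕ} (h : D.v a ≤ D.v D.ϖ ^ r) : D.Near r (upp a) := fun i j => by
  have := pow_nonneg D.ϖ_pos.le r
  fin_cases i <;> fin_cases j <;> simp [upp, h, this]

lemma exists_representatives (r : ℕ) : ∃ X : Finset (GL (Fin 2) k), (∀ x ∈ X, x ∈ D.K) ∧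
    ∀ g, ∃ x ∈ X, ∃ b h : GL (Fin 2) k, b 1 0 = 0 ∧ D.Near r h ∧ g = b * x * h := by
  obtain ⟨T, hT, hcov⟩ := D.exists_net r
  refine ⟨T.image low ∪ T.image fun a => wey * upp a, fun x hx => ?_, fun g => ?_⟩
  · rcases Finset.mem_union.1 hx with hx | hx <;> obtain ⟨a, ha, rfl⟩ := Finset.mem_image.1 hx
    · exact D.low_mem (hT a ha)
    · exact D.K.mul_mem D.wey_mem (D.upp_mem (hT a ha))
  · obtain ⟨b, hb, a, ha, rfl | rfl⟩ := D.exists_iwasawa g <;> obtain ⟨a', ha', h⟩ := hcov a ha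
    · refine ⟨low a', Finset.mem_union_left _ (Finset.mem_image_of_mem _ ha'), b, low (a - a'), hb,
        D.low_near h, ?_⟩
      rw [mul_assoc]
      congr 1
      apply gl2_ext <;> simp [gl2_mul, low]
    · refine ⟨wey * upp a', Finset.mem_union_right _ (Finset.mem_image.2 ⟨a', ha', rfl⟩), b,
        upp (a - a'), hb, D.upp_near h, ?_⟩
      rw [mul_assoc b, mul_assoc wey]
      congr 2
      apply gl2_ext <;> simp [gl2_mul, upp]

/-- A combination of translates of the spherical vector supported on the double coset of `x`. -/
def bump (r : ℕ) (x y : GL (Fin 2) k) : E :=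
  D.phi (y * (x⁻¹ * wey * D.del (r + 1 : ℕ))) - D.χ₁ D.ϖ * D.phi (y * (x⁻¹ * wey * D.del r))

lemma leftEq_phi (g : GL (Fin 2) k) : D.LeftEq fun x => D.phi (x * g) := fun b x hb u₁ u₂ h₁ h₂ => by
  simp only
  rw [mul_assoc, D.phi_borel b _ hb u₁ u₂ h₁ h₂]

lemma leftEq_bump (r : ℕ) (x : GL (Fin 2) k) : D.LeftEq (D.bump r x) :=
  fun b y hb u₁ u₂ h₁ h₂ => by
    have e1 := D.leftEq_phi (x⁻¹ * wey * D.del (r + 1 : ℕ)) b y hb u₁ u₂ h₁ h₂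
    have e2 := D.leftEq_phi (x⁻¹ * wey * D.del r) b y hb u₁ u₂ h₁ h₂
    simp only at e1 e2
    rw [bump, bump, e1, e2]
    ring

lemma rightInv_phi {κ : GL (Fin 2) k} (hκ : κ ∈ D.K) {r s : ℕ} (hr : 1 ≤ r) (hs : s ≤ r) :
    D.RightInv r fun x => D.phi (x * (κ * D.del s)) := fun x h hh => by
  simp only
  rw [← D.phi_mul_K (x * (κ * D.del s)) (D.conj_near_mem hκ hr hs hh)]
  congr 1
  group

lemma rightInv_bump {x : GL (Fin 2) k} (hx : x ∈ D.K) (r : ℕ) :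
    D.RightInv (r + 1) (D.bump r x) := fun y h hh => by
  have hκ := D.K.mul_mem (D.K.inv_mem hx) D.wey_mem
  have e1 := D.rightInv_phi hκ (Nat.le_add_left 1 r) le_rfl y h hh
  have e2 := D.rightInv_phi hκ (Nat.le_add_left 1 r) (Nat.le_succ r) y h hh
  simp only at e1 e2
  rw [bump, bump, e1, e2]

lemma bump_eq (r : ℕ) (x y : GL (Fin 2) k) : ∃ c : E, c ≠ 0 ∧ D.bump r x y =
    c * (D.th (max (D.v ((y * x⁻¹) 1 1) * D.v D.ϖ ^ (r + 1)) (D.v ((y * x⁻¹) 1 0))) -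
      D.th (max (D.v ((y * x⁻¹) 1 1) * D.v D.ϖ ^ r) (D.v ((y * x⁻¹) 1 0)))) := by
  have hrow : ∀ s : ℕ, D.rowNorm (y * (x⁻¹ * wey * D.del s)) =
      max (D.v ((y * x⁻¹) 1 1) * D.v D.ϖ ^ s) (D.v ((y * x⁻¹) 1 0)) := fun s => by
    have e : y * (x⁻¹ * wey * D.del s) = y * x⁻¹ * (wey * D.del s) := by group
    rw [e]
    generalize y * x⁻¹ = z
    simp [rowNorm, gl2_mul, wey, del]
  refine ⟨D.χ₁ (Matrix.GeneralLinearGroup.det (y * (x⁻¹ * wey * D.del (r + 1 : ℕ)))),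
    Units.ne_zero _, ?_⟩
  have hdet : (D.χ₁ D.ϖ : E) * D.χ₁ (Matrix.GeneralLinearGroup.det (y * (x⁻¹ * wey * D.del r))) =
      D.χ₁ (Matrix.GeneralLinearGroup.det (y * (x⁻¹ * wey * D.del (r + 1 : ℕ)))) := by
    rw [← Units.val_mul, ← map_mul]
    congr 2
    simp only [map_mul, det_del]
    rw [zpow_natCast, zpow_natCast, pow_succ]
    simp only [mul_assoc, mul_comm, mul_left_comm]
  rw [bump, phi, phi, hrow, hrow]
  linear_combination -hdet * D.th (max (D.v ((y * x⁻¹) 1 1) * D.v D.ϖ ^ r) (D.v ((y * x⁻¹) 1 0)))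

lemma bump_self_ne_zero (r : ℕ) (x : GL (Fin 2) k) : D.bump r x x ≠ 0 := by
  obtain ⟨c, hc, e⟩ := D.bump_eq r x x
  rw [e]
  refine mul_ne_zero hc ?_
  have hp := D.ϖ_pos
  rw [mul_inv_cancel, gl2_one_11, gl2_one_10, map_one, map_zero, one_mul, one_mul,
    max_eq_left (by positivity), max_eq_left (by positivity), pow_succ', ← map_pow,
    ← Units.val_pow_eq_pow_val, th_mul, th_v, ← sub_one_mul]
  exact mul_ne_zero (sub_ne_zero.2 D.θ_ne_one) (Units.ne_zero _)

lemma exists_of_bump_ne_zero {r : ℕ} {x y : GL (Fin 2) k} (hx : x ∈ D.K) (h : D.bump r x y ≠ 0) :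
    ∃ b n : GL (Fin 2) k, b 1 0 = 0 ∧ D.Near (r + 1) n ∧ y = b * x * n := by
  obtain ⟨c, _, e⟩ := D.bump_eq r x y
  obtain ⟨z, hz⟩ : ∃ z, z = y * x⁻¹ := ⟨_, rfl⟩
  rw [← hz] at e
  have hle : D.v (z 1 0) ≤ D.v (z 1 1) * D.v D.ϖ ^ (r + 1) := by
    by_contra! hlt
    refine h ?_
    have h10 : z 1 0 ≠ 0 := fun h0 => by
      rw [h0, map_zero] at hlt
      exact absurd hlt (not_lt.2 (mul_nonneg (D.v.nonneg _) (pow_nonneg D.ϖ_pos.le _)))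
    have hlt' : D.v (z 1 1) * D.v D.ϖ ^ r ≤ D.v (z 1 0) := by
      have := (D.lt_iff (x := z 1 1 * D.ϖ ^ (r + 1)) h10).1 (by rwa [map_mul, map_pow])
      rw [map_mul, map_pow, pow_succ', mul_left_comm] at this
      exact le_of_mul_le_mul_left this D.ϖ_pos
    rw [e, max_eq_right hlt.le, max_eq_right hlt', sub_self, mul_zero]
  have h11 : z 1 1 ≠ 0 := fun h0 => by
    rw [h0, map_zero, zero_mul] at hle
    have := gl2_det_ne z
    simp [h0, D.v.eq_zero.1 (le_antisymm hle (D.v.nonneg _))] at this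
  have hlow : D.Near (r + 1) (low (z 1 0 / z 1 1)) := D.low_near (by
    rw [map_div₀, div_le_iff₀ (D.v.pos h11), mul_comm]
    exact hle)
  refine ⟨z * low (-(z 1 0 / z 1 1)), x⁻¹ * low (z 1 0 / z 1 1) * x, ?_, ?_, ?_⟩
  · simp only [gl2_mul, low, mk2_00, mk2_10]
    field_simp
    ring
  · have := hlow.conj (D.K.inv_mem hx)
    rwa [inv_inv] at this
  · have : (low (-(z 1 0 / z 1 1)) * low (z 1 0 / z 1 1) : GL (Fin 2) k) = 1 := by
      apply gl2_ext <;> simp [gl2_mul, low]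
    calc y = z * (low (-(z 1 0 / z 1 1)) * low (z 1 0 / z 1 1)) * x := by rw [this, hz]; group
      _ = _ := by group

lemma bump_mem_span (r : ℕ) (x : GL (Fin 2) k) :
    D.bump r x ∈ Submodule.span E (Set.range fun (g y : GL (Fin 2) k) => D.phi (y * g)) := by
  have : D.bump r x = (fun y => D.phi (y * (x⁻¹ * wey * D.del (r + 1 : ℕ)))) -
      (D.χ₁ D.ϖ : E) • fun y => D.phi (y * (x⁻¹ * wey * D.del r)) := rfl
  rw [this]
  exact Submodule.sub_mem _ (Submodule.subset_span ⟨_, rfl⟩)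
    (Submodule.smul_mem _ _ (Submodule.subset_span ⟨_, rfl⟩))

lemma mem_span_of_support (r : ℕ) (X : Finset (GL (Fin 2) k)) :
    (∀ x ∈ X, x ∈ D.K) → ∀ f : GL (Fin 2) k → E, D.LeftEq f → D.RightInv (r + 1) f →
    (∀ y, f y ≠ 0 → ∃ x ∈ X, ∃ b h : GL (Fin 2) k, b 1 0 = 0 ∧ D.Near (r + 1) h ∧ y = b * x * h) →
    f ∈ Submodule.span E (Set.range fun (g y : GL (Fin 2) k) => D.phi (y * g)) := by
  induction X using Finset.induction_on with
  | empty =>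
    intro _ f _ _ hf
    have : f = 0 := by
      ext y
      by_contra h
      obtain ⟨x, hx, _⟩ := hf y h
      simp at hx
    rw [this]
    exact Submodule.zero_mem _
  | insert x X _ ih =>
    intro hX f hl hr hf
    have hxK := hX x (Finset.mem_insert_self _ _)
    obtain ⟨c, hc⟩ : ∃ c, c = f x / D.bump r x x := ⟨_, rfl⟩
    have hlx := D.leftEq_bump r x
    have hrx := D.rightInv_bump hxK r
    have hl' : D.LeftEq (f - c • D.bump r x) := fun b y hb u₁ u₂ h₁ h₂ => by
      simp only [Pi.sub_apply, Pi.smul_apply, smul_eq_mul]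
      rw [hl b y hb u₁ u₂ h₁ h₂, hlx b y hb u₁ u₂ h₁ h₂]
      ring
    have hr' : D.RightInv (r + 1) (f - c • D.bump r x) := fun y h hh => by
      simp only [Pi.sub_apply, Pi.smul_apply, smul_eq_mul]
      rw [hr y h hh, hrx y h hh]
    have hx0 : (f - c • D.bump r x) x = 0 := by
      simp only [Pi.sub_apply, Pi.smul_apply, smul_eq_mul]
      rw [hc, div_mul_cancel₀ _ (D.bump_self_ne_zero r x), sub_self]
    have hmem := ih (fun y hy => hX y (Finset.mem_insert_of_mem hy)) _ hl' hr' fun y hy => by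
      by_cases hyx : ∃ b h : GL (Fin 2) k, b 1 0 = 0 ∧ D.Near (r + 1) h ∧ y = b * x * h
      · obtain ⟨b, h, hb, hh, rfl⟩ := hyx
        obtain ⟨u₁, u₂, h₁, h₂⟩ := exists_diag hb
        rw [hr' _ h hh, hl' b x hb u₁ u₂ h₁ h₂, hx0, mul_zero] at hy
        exact absurd rfl hy
      · have hb0 : D.bump r x y = 0 := by
          by_contra h0
          exact hyx (D.exists_of_bump_ne_zero hxK h0)
        simp only [Pi.sub_apply, Pi.smul_apply, smul_eq_mul, hb0, mul_zero, sub_zero] at hy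
        obtain ⟨x', hx', h'⟩ := hf y hy
        rcases Finset.mem_insert.1 hx' with rfl | hx'
        · exact absurd h' hyx
        · exact ⟨x', hx', h'⟩
    have := Submodule.add_mem _ hmem (Submodule.smul_mem _ c (D.bump_mem_span r x))
    rwa [sub_add_cancel] at this

lemma mem_span_phi {f : GL (Fin 2) k → E} (hl : D.LeftEq f) {r : ℕ} (hr : D.RightInv r f) :
    f ∈ Submodule.span E (Set.range fun (g y : GL (Fin 2) k) => D.phi (y * g)) := by
  obtain ⟨X, hX, hcov⟩ := D.exists_representatives (r + 1)
  exact D.mem_span_of_support r X hX f hl (fun y h hh => hr y h (hh.mono (Nat.le_succ r)))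
    fun y _ => hcov y

end Datum

end Generation

section Lattice

open Polynomial

namespace RepDatum

variable {E : Type} [Field E] (R : RepDatum E)

/-- The integral structure: the `G`-submodule generated by the integral spherical functions. -/
def V0 : AddSubmonoid (GL (Fin 2) R.F → E[X]) :=
  AddSubmonoid.closure {f | ∃ g P, R.InLat g 1 P ∧ f = R.fn g P}

variable {R}

lemma fn_mem_V0 {g : GL (Fin 2) R.F} {P : E[X]} (hP : R.InLat g 1 P) : R.fn g P ∈ R.V0 :=
  AddSubmonoid.subset_closure ⟨g, P, hP, rfl⟩

lemma smul_fn (c : E) (g : GL (Fin 2) R.F) (P : E[X]) : c • R.fn g P = R.fn g (c • P) := by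
  ext1 x
  simp only [fn, Pi.smul_apply]
  rw [smul_comm]

lemma smul_mem_V0 {c : E} (hc : R.abs c ≤ 1) {f : GL (Fin 2) R.F → E[X]} (hf : f ∈ R.V0) :
    c • f ∈ R.V0 := by
  induction hf using AddSubmonoid.closure_induction with
  | mem f hf =>
    obtain ⟨g, P, hP, rfl⟩ := hf
    rw [smul_fn]
    exact fn_mem_V0 (hP.smul (by rwa [mul_one]))
  | zero => rw [smul_zero]; exact zero_mem _
  | add f g _ _ hf hg => rw [smul_add]; exact add_mem hf hg

lemma neg_mem_V0 {f : GL (Fin 2) R.F → E[X]} (hf : f ∈ R.V0) : -f ∈ R.V0 := by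
  rw [← neg_one_smul E f]
  exact smul_mem_V0 (by rw [R.abs.map_neg, map_one]) hf

lemma rhoAct_fn (h g : GL (Fin 2) R.F) (P : E[X]) :
    rhoAct E R.F R.m R.n h (R.fn g P) = R.fn (h * g) (R.tau h P) := by
  ext1 x
  rw [fn, ← map_smul, ← mul_assoc]
  rfl

lemma rhoAct_mem_V0 [CharZero E] (h : GL (Fin 2) R.F) {f : GL (Fin 2) R.F → E[X]}
    (hf : f ∈ R.V0) : rhoAct E R.F R.m R.n h f ∈ R.V0 := by
  induction hf using AddSubmonoid.closure_induction with
  | mem f hf =>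
    obtain ⟨g, P, hP, rfl⟩ := hf
    rw [rhoAct_fn]
    exact fn_mem_V0 (hP.tau h)
  | zero =>
    have : rhoAct E R.F R.m R.n h 0 = 0 := funext fun x => map_zero (R.tau h)
    rw [this]
    exact zero_mem _
  | add f g _ _ hf hg =>
    have : rhoAct E R.F R.m R.n h (f + g) = rhoAct E R.F R.m R.n h f + rhoAct E R.F R.m R.n h g :=
      funext fun x => map_add (R.tau h) _ _
    rw [this]
    exact add_mem hf hg

lemma extChar_eq {F : Subfield E} (χ : Fˣ →* Eˣ) {x : F} {u : Fˣ} (h : x = u) :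
    extChar E F χ x = χ u := by
  subst h
  rw [extChar, dif_neg u.ne_zero]
  congr 2
  exact Units.mk0_val u _

lemma exists_rightInv_phi (g : GL (Fin 2) R.F) : ∃ r, R.D.RightInv r fun x => R.D.phi (x * g) := by
  obtain ⟨r, hr⟩ := R.D.exists_near_conj g 1
  refine ⟨r, fun x h hh => ?_⟩
  simp only
  rw [← R.D.phi_mul_K (x * g) ((hr h hh).mem_K le_rfl)]
  congr 1
  group

lemma isIndFun_iff {f : GL (Fin 2) R.F → E} :
    IsIndFun E R.abs R.F (R.D.ϖ : R.F) R.D.χ₁ R.D.χ₂ f ↔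
      R.D.LeftEq f ∧ ∃ r, R.D.RightInv r f := by
  refine and_congr ⟨fun h b x hb u₁ u₂ h₁ h₂ => ?_, fun h b hb x => ?_⟩
    (exists_congr fun r => forall₂_congr fun x h => imp_congr_left (forall₂_congr fun i j => ?_))
  · rw [h b hb x, extChar_eq _ h₁, extChar_eq _ h₂]
  · obtain ⟨u₁, u₂, h₁, h₂⟩ := Datum.exists_diag hb
    rw [h b x hb u₁ u₂ h₁ h₂, extChar_eq _ h₁, extChar_eq _ h₂]
  · rw [R.hv, R.hv]
    rfl

lemma V0_subset {f : GL (Fin 2) R.F → E[X]} (hf : f ∈ R.V0) :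
    f ∈ Vrho E R.abs R.F (R.D.ϖ : R.F) R.D.χ₁ R.D.χ₂ R.n := by
  induction hf using AddSubmonoid.closure_induction with
  | mem f hf =>
    obtain ⟨g, P, hP, rfl⟩ := hf
    exact Submodule.subset_span ⟨P, fun x => R.D.phi (x * g), hP.degree_le,
      isIndFun_iff.2 ⟨R.D.leftEq_phi g, exists_rightInv_phi g⟩, rfl⟩
  | zero => exact Submodule.zero_mem _
  | add f g _ _ hf hg => exact Submodule.add_mem _ hf hg

lemma exists_Bd (P : E[X]) : ∃ A, Bd R.abs A P := by
  obtain ⟨A, hA⟩ := (P.coeffs.image R.abs).bddAbove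
  refine ⟨max A 0, fun i => ?_⟩
  by_cases h : P.coeff i = 0
  · rw [h, map_zero]; exact le_max_right _ _
  · exact le_max_of_le_left (hA (Finset.mem_coe.2 (Finset.mem_image_of_mem _
      (coeff_mem_coeffs h))))

lemma exists_abs_le {ε : ℝ} (hε : 0 < ε) : ∃ c : E, c ≠ 0 ∧ R.abs c ≤ ε := by
  obtain ⟨N, hN⟩ := exists_pow_lt_of_lt_one hε R.D.ϖ_lt
  refine ⟨R.p ^ N, pow_ne_zero _ R.p_ne_zero, ?_⟩
  rw [map_pow, abs_p]
  exact hN.le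

lemma fn_mem_span [CharZero E] (g : GL (Fin 2) R.F) {P : E[X]} (hP : P.degree ≤ R.n) :
    R.fn g P ∈ Submodule.span E (R.V0 : Set (GL (Fin 2) R.F → E[X])) := by
  obtain ⟨A, hA⟩ := exists_Bd (R := R) (R.tau g⁻¹ P)
  have hA0 := hA.nonneg
  obtain ⟨c, hc0, hc⟩ := exists_abs_le (R := R) (ε := 1 / (A + 1)) (by positivity)
  have hL : R.InLat g 1 (c • P) := by
    refine InLat.smul (ε := A) ⟨_, R.degree_tau_le _ _, hA, ?_⟩ ?_
    · rw [← tau_mul, mul_inv_cancel, R.tau_one hP]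
    · rw [le_div_iff₀ (by positivity)] at hc
      nlinarith [R.abs.nonneg c]
  have : R.fn g P = c⁻¹ • R.fn g (c • P) := by
    rw [smul_fn, smul_smul, inv_mul_cancel₀ hc0, one_smul]
  rw [this]
  exact Submodule.smul_mem _ _ (Submodule.subset_span (fn_mem_V0 hL))

lemma span_V0 [CharZero E] : Submodule.span E (R.V0 : Set (GL (Fin 2) R.F → E[X])) =
    Vrho E R.abs R.F (R.D.ϖ : R.F) R.D.χ₁ R.D.χ₂ R.n := by
  refine le_antisymm (Submodule.span_le.2 fun f hf => V0_subset hf) (Submodule.span_le.2 ?_)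
  rintro _ ⟨P, f, hP, hf, rfl⟩
  obtain ⟨hl, r, hr⟩ := isIndFun_iff.1 hf
  have := R.D.mem_span_phi hl hr
  clear hf hl hr
  induction this using Submodule.span_induction with
  | mem f hf =>
    obtain ⟨g, rfl⟩ := hf
    exact fn_mem_span g hP
  | zero => simp only [Pi.zero_apply, zero_smul]; exact Submodule.zero_mem _
  | add f g _ _ hf hg =>
    simp only [Pi.add_apply, add_smul]
    exact Submodule.add_mem _ hf hg
  | smul c f _ hf =>
    simp only [Pi.smul_apply, smul_assoc]
    exact Submodule.smul_mem _ c hf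

lemma abs_central (j : ℤ) :
    R.abs (((R.D.χ₁ R.D.ϖ * R.D.χ₂ R.D.ϖ) ^ j : Eˣ) * (R.p ^ (2 * R.m + R.n)) ^ j) = 1 := by
  rw [Units.val_zpow_eq_zpow_val, Units.val_mul, ← mul_zpow, map_zpow₀, p, R.bs_eq, _root_.one_zpow]

lemma V0_smul_mem_M [CharZero E] {f : GL (Fin 2) R.F → E[X]} (hf : f ∈ R.V0) :
    ∃ r, ∀ c ε, R.abs c ≤ ε → c • f ∈ R.M r ε := by
  induction hf using AddSubmonoid.closure_induction with
  | mem f hf =>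
    obtain ⟨g, P, hP, rfl⟩ := hf
    obtain ⟨j, κ, hκ, r, κ', hκ', rfl⟩ := R.D.exists_cartan g
    obtain ⟨Q, hQ, hQ1, rfl⟩ := hP.mul_K hκ'
    refine ⟨r, fun c ε hc => ?_⟩
    have : c • R.fn (R.D.scal j * (κ * R.D.del r) * κ')
        (R.tau (R.D.scal j * (κ * R.D.del r)) Q) = R.fn (κ * R.D.del r)
        ((c * (((R.D.χ₁ R.D.ϖ * R.D.χ₂ R.D.ϖ) ^ j : Eˣ) * (R.p ^ (2 * R.m + R.n)) ^ j)) •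
          R.tau (κ * R.D.del r) Q) := by
      ext1 x
      simp only [fn, Pi.smul_apply]
      rw [← mul_assoc x, R.D.phi_mul_K _ hκ', ← mul_assoc x, R.D.scal_comm, mul_assoc (R.D.scal j),
        R.D.phi_scal, tau_mul, R.tau_scal _ (R.degree_tau_le _ _), smul_smul, smul_smul, smul_smul]
      congr 1
      ring
    rw [this]
    refine fn_mem_M hκ le_rfl (InLat.smul ⟨Q, hQ, hQ1, rfl⟩ ?_)
    rw [map_mul, abs_central, mul_one, mul_one]
    exact hc
  | zero => exact ⟨0, fun c ε _ => by rw [smul_zero]; exact zero_mem _⟩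
  | add f g _ _ hf hg =>
    obtain ⟨r, hr⟩ := hf
    obtain ⟨s, hs⟩ := hg
    refine ⟨max r s, fun c ε hc => ?_⟩
    rw [smul_add]
    exact add_mem (M_mono (le_max_left _ _) _ (hr c ε hc)) (M_mono (le_max_right _ _) _ (hs c ε hc))

lemma V0_rightInv {f : GL (Fin 2) R.F → E[X]} (hf : f ∈ R.V0) : ∃ r, 1 ≤ r ∧ R.D.RightInv r f := by
  induction hf using AddSubmonoid.closure_induction with
  | mem f hf =>
    obtain ⟨g, P, hP, rfl⟩ := hf
    obtain ⟨r, hr⟩ := exists_rightInv_phi g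
    refine ⟨r + 1, by omega, fun x h hh => ?_⟩
    have := hr x h (hh.mono (by omega))
    simp only at this
    rw [fn, fn, this]
  | zero => exact ⟨1, le_rfl, fun x h _ => rfl⟩
  | add f g _ _ hf hg =>
    obtain ⟨r, hr1, hr⟩ := hf
    obtain ⟨s, hs1, hs⟩ := hg
    refine ⟨max r s, le_max_of_le_left hr1, fun x h hh => ?_⟩
    rw [Pi.add_apply, Pi.add_apply, hr x h (hh.mono (le_max_left _ _)),
      hs x h (hh.mono (le_max_right _ _))]

lemma V0_leftEq {f : GL (Fin 2) R.F → E[X]} (hf : f ∈ R.V0) {b : GL (Fin 2) R.F} (hb : b 1 0 = 0)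
    (x : GL (Fin 2) R.F) (hx : f x = 0) : f (b * x) = 0 := by
  obtain ⟨u₁, u₂, h₁, h₂⟩ := Datum.exists_diag hb
  have : f (b * x) = (R.D.χ₁ u₁ * R.D.χ₂ u₂ : E) • f x := by
    clear hx
    induction hf using AddSubmonoid.closure_induction with
    | mem f hf =>
      obtain ⟨g, P, hP, rfl⟩ := hf
      have := R.D.leftEq_phi g b x hb u₁ u₂ h₁ h₂
      simp only at this
      rw [fn, fn, this, smul_smul]
    | zero => simp
    | add f g _ _ hf hg => rw [Pi.add_apply, Pi.add_apply, hf, hg, smul_add]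
  rw [this, hx, smul_zero]

lemma exists_abs_phi_le (s : ℕ) : ∃ C, 0 ≤ C ∧ ∀ κ ∈ R.D.K, R.abs (R.D.phi (κ * R.D.del s)) ≤ C := by
  obtain ⟨X, hX, hcov⟩ := R.D.exists_representatives (s + 1)
  refine ⟨∑ x ∈ X, R.abs (R.D.phi (x * R.D.del s)), Finset.sum_nonneg fun _ _ => R.abs.nonneg _,
    fun κ hκ => ?_⟩
  obtain ⟨x, hx, b, h, hb, hh, rfl⟩ := hcov κ
  have hbK : b ∈ R.D.K := by
    have := R.D.K.mul_mem hκ (R.D.K.inv_mem (R.D.K.mul_mem (hX x hx) (hh.mem_K (by omega))))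
    rwa [show b * x * h * (x * h)⁻¹ = b by group] at this
  obtain ⟨u₁, u₂, h₁, h₂⟩ := Datum.exists_diag hb
  have e := hbK.2
  have e₁ := hbK.1 0 0
  have e₂ := hbK.1 1 1
  rw [hb, mul_zero, sub_zero, map_mul] at e
  rw [h₁, h₂] at e
  rw [h₁] at e₁
  rw [h₂] at e₂
  have n₁ := R.D.v.nonneg (u₁ : R.F)
  have n₂ := R.D.v.nonneg (u₂ : R.F)
  have i := R.D.rightInv_phi (one_mem R.D.K) (r := s + 1) (s := s) (by omega) (by omega) (b * x) h hh
  simp only [one_mul] at i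
  rw [i, mul_assoc, R.D.phi_borel b _ hb u₁ u₂ h₁ h₂, R.D.unr₁ u₁ (by nlinarith),
    R.D.unr₂ u₂ (by nlinarith), Units.val_one, one_mul, one_mul]
  exact Finset.single_le_sum (f := fun x => R.abs (R.D.phi (x * R.D.del s)))
    (fun _ _ => R.abs.nonneg _) hx

lemma Bd_tau_del_nat [CharZero E] (s : ℕ) {ε : ℝ} {P : E[X]} (hd : P.degree ≤ R.n)
    (hP : Bd R.abs ε P) :
    Bd R.abs ((R.abs R.p ^ R.m) ^ s * ε) (R.tau (R.D.del s) P) := by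
  induction s with
  | zero =>
    have : R.D.del (0 : ℕ) = 1 := by apply gl2_ext <;> simp [Datum.del]
    rw [this, R.tau_one hd, pow_zero, one_mul]
    exact hP
  | succ s ih =>
    rw [Nat.cast_succ, add_comm (s : ℤ), R.D.del_add, tau_mul, pow_succ', mul_assoc]
    exact R.Bd_tau_del ih

lemma M_bounded [CharZero E] (r : ℕ) : ∃ C, 0 ≤ C ∧ ∀ ε, 0 ≤ ε → ∀ f ∈ R.M r ε, ∀ κ ∈ R.D.K,
    Bd R.abs (C * ε) (f κ) := by
  choose A hA0 hA using exists_abs_phi_le (R := R)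
  have ha : ∀ s, 0 ≤ (R.abs R.p ^ R.m) ^ s := fun s => pow_nonneg (zpow_nonneg (R.abs.nonneg _) _) _
  have hC : ∀ s, 0 ≤ A s * (R.abs R.p ^ R.m) ^ s := fun s => mul_nonneg (hA0 s) (ha s)
  refine ⟨∑ s ∈ Finset.range (r + 1), A s * (R.abs R.p ^ R.m) ^ s,
    Finset.sum_nonneg fun s _ => hC s, fun ε hε f hf κ hκ => ?_⟩
  induction hf using AddSubmonoid.closure_induction with
  | mem f hf =>
    obtain ⟨κ', hκ', s, hs, _, ⟨Q, hQ, hQ1, rfl⟩, rfl⟩ := hf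
    have h1 := R.Bd_tau hκ' (Bd_tau_del_nat s hQ hQ1)
    rw [← tau_mul] at h1
    refine (Bd.smul (R.D.phi (κ * (κ' * R.D.del s))) h1).mono ?_
    rw [← mul_assoc κ, ← mul_assoc]
    refine mul_le_mul_of_nonneg_right ?_ hε
    refine (mul_le_mul_of_nonneg_right (hA s _ (R.D.K.mul_mem hκ hκ')) (ha s)).trans ?_
    exact Finset.single_le_sum (f := fun s => A s * (R.abs R.p ^ R.m) ^ s) (fun s _ => hC s)
      (Finset.mem_range.2 (by omega))
  | zero => exact Bd.zero (mul_nonneg (Finset.sum_nonneg fun s _ => hC s) hε)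
  | add f g _ _ hf hg => exact hf.add R.na hg

lemma eq_zero_of_line [CharZero E] {f : GL (Fin 2) R.F → E[X]} (hf : ∀ c : E, c • f ∈ R.V0) :
    f = 0 := by
  have hf1 : f ∈ R.V0 := by simpa using hf 1
  obtain ⟨r, hr, hinv⟩ := V0_rightInv hf1
  obtain ⟨C, hC, hbd⟩ := M_bounded (R := R) r
  have hM : ∀ ε, 0 < ε → f ∈ R.M r ε := fun ε hε => by
    obtain ⟨c, hc0, hc⟩ := exists_abs_le (R := R) hε
    obtain ⟨s, hs⟩ := V0_smul_mem_M (hf c⁻¹)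
    have := hs c ε hc
    rw [smul_inv_smul₀ hc0] at this
    exact M_descent_le hr (le_max_left r s) hε.le (M_mono (le_max_right r s) ε this) hinv
  have hK : ∀ κ ∈ R.D.K, f κ = 0 := fun κ hκ => by
    ext i
    rw [coeff_zero, ← R.abs.eq_zero]
    refine le_antisymm (le_of_forall_pos_le_add fun δ hδ => ?_) (R.abs.nonneg _)
    have h := hbd (δ / (C + 1)) (by positivity) f (hM _ (by positivity)) κ hκ i
    rw [zero_add]
    refine h.trans ?_
    rw [mul_div_assoc', div_le_iff₀ (by positivity)]
    nlinarith
  obtain ⟨X, hX, hcov⟩ := R.D.exists_representatives 1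
  ext1 g
  obtain ⟨x, hx, b, h, hb, hh, rfl⟩ := hcov g
  rw [mul_assoc]
  exact V0_leftEq hf1 hb _ (hK _ (R.D.K.mul_mem (hX x hx) (hh.mem_K le_rfl)))

end RepDatum

end Lattice

lemma RepDatum.exists_integral_structure {E : Type} [Field E] [CharZero E] (R : RepDatum E) :
    ∃ V0 : Set (GL (Fin 2) R.F → Polynomial E),
      V0 ⊆ (Vrho E R.abs R.F (R.D.ϖ : R.F) R.D.χ₁ R.D.χ₂ R.n :
        Set (GL (Fin 2) R.F → Polynomial E)) ∧
      (0 : GL (Fin 2) R.F → Polynomial E) ∈ V0 ∧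
      (∀ x ∈ V0, ∀ y ∈ V0, x + y ∈ V0) ∧
      (∀ x ∈ V0, -x ∈ V0) ∧
      (∀ c : E, R.abs c ≤ 1 → ∀ x ∈ V0, c • x ∈ V0) ∧
      (∀ g : GL (Fin 2) R.F, ∀ x ∈ V0, rhoAct E R.F R.m R.n g x ∈ V0) ∧
      Submodule.span E V0 = Vrho E R.abs R.F (R.D.ϖ : R.F) R.D.χ₁ R.D.χ₂ R.n ∧
      (∀ x : GL (Fin 2) R.F → Polynomial E, x ≠ 0 → ¬ (∀ c : E, c • x ∈ V0)) :=
  ⟨R.V0, fun _ => V0_subset, zero_mem _, fun _ hx _ hy => add_mem hx hy, fun _ => neg_mem_V0,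
    fun _ hc _ => smul_mem_V0 hc, fun g _ => rhoAct_mem_V0 g, span_V0,
    fun _ hx h => hx (eq_zero_of_line h)⟩

section Residue

variable {E}

lemma mkW_eq_zero {abs : AbsoluteValue E ℝ} {na : ∀ x y : E, abs (x + y) ≤ max (abs x) (abs y)}
    {F : Subfield E} (x : F) : mkW E abs na F x = 0 ↔ abs (x : E) ≤ 1 :=
  QuotientAddGroup.eq_zero_iff x

/-- The fibre of multiplication by `π` on `F / 𝒪` over `0` provides representatives of the residue
field. -/
lemma exists_residue_representatives {abs : AbsoluteValue E ℝ}
    {na : ∀ x y : E, abs (x + y) ≤ max (abs x) (abs y)} {F : Subfield E} {π : F}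
    (hπ0 : π ≠ 0) (hπ1 : abs (π : E) < 1)
    (hdisc : ∀ x : F, x ≠ 0 → ∃ k : ℤ, abs (x : E) = abs (π : E) ^ k) {q : ℕ} (hq : 0 < q)
    (hcard : Nat.card {β : Wq E abs na F // pmulW E abs na F π hπ1.le β = 0} = q) :
    ∃ t : Fin q → F, (∀ b, abs (t b : E) ≤ 1) ∧
      (∀ b b', b ≠ b' → abs ((t b - t b' : F) : E) = 1) ∧
      ∀ x : F, abs (x : E) ≤ 1 → ∃ b, abs ((x - t b : F) : E) ≤ abs (π : E) := by
  have hpE : (π : E) ≠ 0 := by exact_mod_cast hπ0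
  have hp : 0 < abs (π : E) := abs.pos hpE
  have hfib : ∀ x : F, pmulW E abs na F π hπ1.le (mkW E abs na F x) = 0 ↔
      abs ((π * x : F) : E) ≤ 1 := fun x => mkW_eq_zero (na := na) (π * x)
  have : Finite {β : Wq E abs na F // pmulW E abs na F π hπ1.le β = 0} :=
    Nat.finite_of_card_ne_zero (by omega)
  let e := (Finite.equivFinOfCardEq hcard).symm
  have hsurj : ∀ b, ∃ x : F, mkW E abs na F x = (e b).1 := fun b =>
    QuotientAddGroup.mk'_surjective _ _
  choose x hx using hsurj
  have hintegral : ∀ b, abs ((π * x b : F) : E) ≤ 1 := fun b => by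
    rw [← hfib, hx]
    exact (e b).2
  refine ⟨fun b => π * x b, hintegral, fun b b' hb => ?_, fun y hy => ?_⟩
  · have hle : abs ((π * x b - π * x b' : F) : E) ≤ 1 := by
      rw [Subfield.coe_sub, sub_eq_add_neg]
      refine (na _ _).trans (max_le (hintegral b) ?_)
      rw [abs.map_neg]
      exact hintegral b'
    refine hle.antisymm ?_
    by_contra! hlt
    refine hb (e.injective (Subtype.ext ?_))
    rw [← hx, ← hx, ← sub_eq_zero, ← map_sub, mkW_eq_zero]
    rcases eq_or_ne (x b - x b') 0 with h0 | h0
    · simp [h0]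
    obtain ⟨j, hj⟩ := hdisc _ h0
    rw [← mul_sub, Subfield.coe_mul, map_mul, hj, ← zpow_one_add₀ hp.ne'] at hlt
    rw [hj]
    have : 0 ≤ j := by
      by_contra! hneg
      exact absurd hlt (not_lt.2 (one_le_zpow_of_nonpos₀ hp hπ1.le (by omega)))
    lift j to ℕ using this
    rw [zpow_natCast]
    exact pow_le_one₀ hp.le hπ1.le
  · have hy' : pmulW E abs na F π hπ1.le (mkW E abs na F (y / π)) = 0 := by
      rw [hfib, mul_div_cancel₀ _ hπ0]
      exact hy
    obtain ⟨b, hb⟩ := e.surjective ⟨_, hy'⟩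
    refine ⟨b, ?_⟩
    have h1 : mkW E abs na F (y / π - x b) = 0 := by
      rw [map_sub, hx, hb, sub_self]
    rw [mkW_eq_zero] at h1
    have h2 : (y - π * x b : F) = π * (y / π - x b) := by field_simp
    rw [h2, Subfield.coe_mul, map_mul]
    exact mul_le_of_le_one_right hp.le h1

end Residue

/-- Theorem 1.1, case (1), of the paper: for unramified smooth characters
`χ₁, χ₂` with `σ = Ind_B^G(χ₁,χ₂)` irreducible, `τ = det(·)^m ⊗ Sym^n` with `n < q`, and
the Breuil–Schneider conditions satisfied, `ρ = τ ⊗ σ` admits an integral structure. -/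
theorem stmt0 [CharZero E] [IsAlgClosed E]
    (abs : AbsoluteValue E ℝ)
    (na : ∀ x y : E, abs (x + y) ≤ max (abs x) (abs y))
    (F : Subfield E) (π : F)
    (hπ0 : π ≠ 0) (hπ1 : abs (π : E) < 1)
    (hdisc : ∀ x : F, x ≠ 0 → ∃ k : ℤ, abs (x : E) = abs (π : E) ^ k)
    -- the residue field of `F` has `q` elements
    (q : ℕ) (hq : 0 < q)
    (hcard : ∀ γ : Wq E abs na F,
      Nat.card {β : Wq E abs na F // pmulW E abs na F π hπ1.le β = γ} = q)
    (χ1 χ2 : Fˣ →* Eˣ)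
    -- `χ₁` and `χ₂` are unramified (trivial on `U_F`; in particular smooth):
    (hunr1 : ∀ u : Fˣ, abs ((u : F) : E) = 1 → χ1 u = 1)
    (hunr2 : ∀ u : Fˣ, abs ((u : F) : E) = 1 → χ2 u = 1)
    (m : ℤ) (n : ℕ) (hn : n < q)
    (lam mu lamT muT : E)
    (hlam : lam = (χ1 (Units.mk0 π hπ0) : E))
    (hmu : mu = (q : E)⁻¹ * (χ2 (Units.mk0 π hπ0) : E))
    (hlamt : lamT = lam * (π : E) ^ m)
    (hmut : muT = mu * (π : E) ^ m)
    -- `σ` is irreducible, i.e. `χ₁/(ωχ₂) ≠ ω^{±1}`; for unramified characters this reads: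
    (hirr : lam ≠ (q : E)⁻¹ * mu ∧ lam ≠ (q : E) * mu)
    -- the Breuil–Schneider conditions:
    (hBS1 : abs (lamT * muT * (q : E) * (π : E) ^ (n : ℕ)) = 1)
    (hBS2 : abs lamT ≤ abs ((q : E)⁻¹ * (π : E) ^ (-(n : ℤ))))
    (hBS3 : abs muT ≤ abs ((q : E)⁻¹ * (π : E) ^ (-(n : ℤ)))) :
    ∃ V0 : Set (GL (Fin 2) F → Polynomial E),
      -- `V⁰` is contained in `V_ρ`:
      V0 ⊆ (Vrho E abs F π χ1 χ2 n : Set (GL (Fin 2) F → Polynomial E)) ∧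
      -- `V⁰` is an `O_E`-submodule:
      (0 : GL (Fin 2) F → Polynomial E) ∈ V0 ∧
      (∀ x ∈ V0, ∀ y ∈ V0, x + y ∈ V0) ∧
      (∀ x ∈ V0, -x ∈ V0) ∧
      (∀ c : E, abs c ≤ 1 → ∀ x ∈ V0, c • x ∈ V0) ∧
      -- `V⁰` is stable under `G`:
      (∀ g : GL (Fin 2) F, ∀ x ∈ V0, rhoAct E F m n g x ∈ V0) ∧
      -- `V⁰` spans `V_ρ` over `E`:
      Submodule.span E V0 = Vrho E abs F π χ1 χ2 n ∧
      -- `V⁰` contains no `E`-line: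
      (∀ x : GL (Fin 2) F → Polynomial E, x ≠ 0 → ¬ (∀ c : E, c • x ∈ V0)) := by
  have hpE : (π : E) ≠ 0 := by exact_mod_cast hπ0
  have hqE : (q : E) ≠ 0 := by exact_mod_cast hq.ne'
  have hp : 0 < abs (π : E) := abs.pos hpE
  obtain ⟨t, t_int, t_sep, t_cov⟩ := exists_residue_representatives hπ0 hπ1 hdisc hq (hcard 0)
  let D : Datum F E :=
    { v := abs.comp (f := F.subtype) Subtype.val_injective
      na := fun x y => na x y
      ϖ := Units.mk0 π hπ0
      ϖ_lt := hπ1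
      disc := hdisc
      q := q
      t := t
      t_int := t_int
      t_sep := t_sep
      t_cov := t_cov
      χ₁ := χ1
      χ₂ := χ2
      unr₁ := hunr1
      unr₂ := hunr2
      hne := fun h => hirr.2 (by rw [hlam, hmu, h, mul_inv_cancel_left₀ hqE]) }
  have hbound : ∀ x : E, abs x ≤ abs ((q : E)⁻¹ * (π : E) ^ (-(n : ℤ))) →
      abs (q * x * (π : E) ^ (n : ℤ)) ≤ 1 := fun x hx => by
    rw [mul_right_comm, map_mul]
    refine (mul_le_mul_of_nonneg_left hx (abs.nonneg _)).trans_eq ?_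
    rw [← map_mul, mul_mul_mul_comm, mul_inv_cancel₀ hqE, ← zpow_add₀ hpE, add_neg_cancel, zpow_zero,
      one_mul, map_one]
  let R : RepDatum E :=
    { abs := abs
      na := na
      F := F
      D := D
      hv := fun _ => rfl
      m := m
      n := n
      hn := hn
      bs_eq := by
        rw [← hBS1, hmut, hlamt, hmu, hlam]
        congr 1
        change (χ1 (Units.mk0 π hπ0) : E) * χ2 (Units.mk0 π hπ0) * (π : E) ^ (2 * m + n : ℤ) = _
        rw [zpow_add₀ hpE, two_mul, zpow_add₀ hpE, zpow_natCast]
        field_simp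
      bs_le := by
        change abs (((χ2 (Units.mk0 π hπ0) : E) + q * χ1 (Units.mk0 π hπ0)) *
          (π : E) ^ (m + n : ℤ)) ≤ 1
        have e : ((χ2 (Units.mk0 π hπ0) : E) + q * χ1 (Units.mk0 π hπ0)) * (π : E) ^ (m + n : ℤ) =
            q * muT * (π : E) ^ (n : ℤ) + q * lamT * (π : E) ^ (n : ℤ) := by
          rw [hmut, hlamt, hmu, hlam, zpow_add₀ hpE]
          field_simp
        rw [e]
        exact (na _ _).trans (max_le (hbound _ hBS3) (hbound _ hBS2)) }
  exact R.exists_integral_structure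

end BS
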